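/- arXiv:math/0204063 — 2 statements merged into one kernel-verified Lean document; each statement's English description precedes it below -/
import Mathlib

section
/- Let γ : ℝ/Lℤ → ℝⁿ (n ≥ 2) be a knot (simple closed unit-speed C^{1,1} curve) with image K, and let γ_m : ℝ/Lℤ → ℝⁿ be a sequence of C^{1,1} simple closed curves with nowhere-vanishing derivative such that γ_m → γ and γ_m' → γ' uniformly, satisfying: (a) there is C < ∞ such that for every m the unit tangent field T_m = γ_m'/‖γ_m'‖ of γ_m is C-Lipschitz with respect to the arclength of γ_m; and (b) there is a compact set A ⊂ ℝ/Lℤ with {s : γ_m(s) ≠ γ(s)} ⊆ A for all m. If F_k(γ) < MDC(K)/2 and for every m the unit tangent field T_m is (1/F_k(γ))-Lipschitz with respect to the arclength of γ_m (i.e. F_k(γ_m) ≥ F_k(γ)), then there exists m₁ such that R_O(K_m) ≥ R_O(K) for all m ≥ m₁, where K_m is the image of γ_m. -/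
open Set Filter MeasureTheory
open scoped RealInnerProductSpace Topology ENNReal

noncomputable section

/-- Euclidean space `ℝⁿ`. -/
abbrev Euc (n : ℕ) := EuclideanSpace ℝ (Fin n)

/-- Generalized curvature `κγ(s)` of a curve with derivative `γd` and parameter domain `D`:
the limsup, as `x, y → s` with `x ≠ y`, of `∠(γd x, γd y) / |x - y|`, expressed as the
infimum of all eventual bounds. -/
def curvAt {n : ℕ} (γd : ℝ → Euc n) (D : Set ℝ) (s : ℝ) : ℝ :=
  sInf {Λ : ℝ | 0 ≤ Λ ∧ ∃ δ > 0, ∀ x ∈ D, ∀ y ∈ D, x ≠ y →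
    |x - s| < δ → |y - s| < δ →
    InnerProductGeometry.angle (γd x) (γd y) ≤ Λ * |x - y|}

/-- `κγ(s) < Λ`: there are `δ > 0` and `Λ' < Λ` bounding the angle dilation near `s`. -/
def CurvLt {n : ℕ} (γd : ℝ → Euc n) (D : Set ℝ) (s Λ : ℝ) : Prop :=
  ∃ δ > 0, ∃ Λ' < Λ, ∀ x ∈ D, ∀ y ∈ D, x ≠ y → |x - s| < δ → |y - s| < δ →
    InnerProductGeometry.angle (γd x) (γd y) ≤ Λ' * |x - y|

/-- `f` restricted to `[a, c]` is a planar circular arc of radius `1/Λ`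
of length in `[0, 2π/Λ)`. -/
def IsArc {n : ℕ} (Λ : ℝ) (f : ℝ → Euc n) (a c : ℝ) : Prop :=
  c - a < 2 * Real.pi / Λ ∧
  ∃ (o u e : Euc n) (s₁ : ℝ), ‖u‖ = 1 ∧ ‖e‖ = 1 ∧ ⟪u, e⟫ = 0 ∧
    ∀ s ∈ Icc a c,
      f s = o + (Λ⁻¹ * Real.cos (Λ * (s - s₁))) • u + (Λ⁻¹ * Real.sin (Λ * (s - s₁))) • e

/-- `f` restricted to `[a, c]` is a planar circular arc of radius `r`. -/
def IsArcR {n : ℕ} (r : ℝ) (f : ℝ → Euc n) (a c : ℝ) : Prop :=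
  ∃ (o u e : Euc n) (s₁ : ℝ), ‖u‖ = 1 ∧ ‖e‖ = 1 ∧ ⟪u, e⟫ = 0 ∧
    ∀ s ∈ Icc a c,
      f s = o + (r * Real.cos ((s - s₁) / r)) • u + (r * Real.sin ((s - s₁) / r)) • e

/-- `O_p(v, r)`: the union of the open balls of radius `r` tangent to `v^⊥` at `p`. -/
def Odisk {n : ℕ} (p v : Euc n) (r : ℝ) : Set (Euc n) :=
  {x | ∃ w : Euc n, ‖w‖ = 1 ∧ ⟪w, v⟫ = 0 ∧ ‖x - p - r • w‖ < r}

/-- Ball radius `R_O` of the curve `f` (with derivative/tangent field `γd`) on domain `D`. -/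
def RO {n : ℕ} (f γd : ℝ → Euc n) (D : Set ℝ) : ℝ :=
  sInf {r : ℝ | 0 < r ∧ ∃ s ∈ D, ∃ t ∈ D, ∃ w : Euc n,
    ‖w‖ = 1 ∧ ⟪w, γd s⟫ = 0 ∧ ‖f t - f s - r • w‖ < r}

/-- Minimal double critical distance of the curve `f` with tangent field `γd`. -/
def MDC {n : ℕ} (f γd : ℝ → Euc n) : ℝ :=
  sInf {d : ℝ | ∃ x y : ℝ, f x ≠ f y ∧ ⟪f x - f y, γd x⟫ = 0 ∧
    ⟪f x - f y, γd y⟫ = 0 ∧ d = ‖f x - f y‖}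

/-- Normal injectivity radius `i(K, ℝⁿ)` of the curve `f` with tangent field `γd`. -/
def injRad {n : ℕ} (f γd : ℝ → Euc n) : ℝ :=
  sSup ({0} ∪ {r : ℝ | 0 < r ∧ ∀ s t : ℝ, ∀ u w : Euc n,
    ⟪u, γd s⟫ = 0 → ⟪w, γd t⟫ = 0 → ‖u‖ < r → ‖w‖ < r →
    f s + u = f t + w → f s = f t ∧ u = w})

/-- A knot: a simple closed unit-speed `C^{1,1}` curve, as an `L`-periodic map `ℝ → ℝⁿ`,
injective on `[0, L)`, with `‖γ'‖ ≡ 1` and `γ'` Lipschitz. -/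
structure Knot (n : ℕ) where
  L : ℝ
  Lpos : 0 < L
  f : ℝ → Euc n
  fd : ℝ → Euc n
  per : ∀ s, f (s + L) = f s
  perd : ∀ s, fd (s + L) = fd s
  deriv : ∀ s, HasDerivAt f (fd s) s
  unit : ∀ s, ‖fd s‖ = 1
  lipd : ∃ C : NNReal, LipschitzWith C fd
  inj : InjOn f (Ico 0 L)

/-- Ropelength `ℓ_e(γ) = L / R_O(K)`. -/
def Knot.ropelength {n : ℕ} (k : Knot n) : ℝ := k.L / RO k.f k.fd univ

/-- The set `I_c` of parameters realizing the minimal double critical distance. -/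
def Knot.Ic {n : ℕ} (k : Knot n) : Set ℝ :=
  {x | ∃ y : ℝ, k.f x ≠ k.f y ∧ ⟪k.f x - k.f y, k.fd x⟫ = 0 ∧
    ⟪k.f x - k.f y, k.fd y⟫ = 0 ∧ ‖k.f x - k.f y‖ = MDC k.f k.fd}

/-- `sup_s κγ(s)` for a knot. -/
def Knot.supCurv {n : ℕ} (k : Knot n) : ℝ := ⨆ s : ℝ, curvAt k.fd univ s

/-- Analytic focal distance `F_k(γ) = (sup_s κγ(s))⁻¹`. -/
def Knot.Fk {n : ℕ} (k : Knot n) : ℝ := (k.supCurv)⁻¹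

/-- Two knots are in the same knot class: after rescaling their domains to `ℝ/ℤ`
(realized by `1`-periodic maps `ℝ → ℝⁿ`), they are joined by a continuous homotopy
through injective loops. -/
def SameKnotClass {n : ℕ} (k₁ k₂ : Knot n) : Prop :=
  ∃ H : ℝ → ℝ → Euc n,
    ContinuousOn (fun z : ℝ × ℝ => H z.1 z.2) (Icc 0 1 ×ˢ univ) ∧
    (∀ t s, H t (s + 1) = H t s) ∧
    (∀ s, H 0 s = k₁.f (k₁.L * s)) ∧
    (∀ s, H 1 s = k₂.f (k₂.L * s)) ∧
    ∀ t ∈ Icc (0 : ℝ) 1, InjOn (H t) (Ico 0 1)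

/-- A knot is relatively extremal: a relative minimum of ropelength within its knot class
with respect to the `C¹` topology (on rescaled parametrizations). -/
def RelativelyExtremal {n : ℕ} (k : Knot n) : Prop :=
  ∃ ε > 0, ∀ η : Knot n, SameKnotClass k η →
    (∀ s : ℝ, ‖η.f (η.L * s) - k.f (k.L * s)‖ +
      ‖η.L • η.fd (η.L * s) - k.L • k.fd (k.L * s)‖ < ε) →
    k.ropelength ≤ η.ropelength

/-- The class `C(p, q; v, w; Λ)`: unit-speed `C^{1,1}` curves `γ : [0, L] → ℝⁿ`
(`L` not fixed) from `p` to `q` with initial/terminal directions `v, w`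
and `Λ`-Lipschitz derivative (curvature at most `Λ`). -/
structure CurveCC (n : ℕ) (p q v w : Euc n) (Λ : ℝ) where
  L : ℝ
  Lnn : 0 ≤ L
  f : ℝ → Euc n
  fd : ℝ → Euc n
  deriv : ∀ s ∈ Icc (0 : ℝ) L, HasDerivWithinAt f (fd s) (Icc 0 L) s
  unit : ∀ s ∈ Icc (0 : ℝ) L, ‖fd s‖ = 1
  lip : LipschitzOnWith Λ.toNNReal fd (Icc 0 L)
  i0 : f 0 = p
  id0 : fd 0 = v
  iL : f L = q
  idL : fd L = w

/-- A `C¹` closed curve of period `L` with nowhere-vanishing derivative. -/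
structure ClosedC1 (n : ℕ) (L : ℝ) where
  f : ℝ → Euc n
  fd : ℝ → Euc n
  per : ∀ s, f (s + L) = f s
  perd : ∀ s, fd (s + L) = fd s
  deriv : ∀ s, HasDerivAt f (fd s) s
  nz : ∀ s, fd s ≠ 0

/-- A simple closed `C^{1,1}` curve of period `L` with nowhere-vanishing derivative. -/
structure ClosedC11 (n : ℕ) (L : ℝ) extends ClosedC1 n L where
  lipd : ∃ C : NNReal, LipschitzWith C fd
  inj : InjOn f (Ico 0 L)

/-- The unit tangent field of `c` is `C`-Lipschitz with respect to the arclength of `c`. -/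
def TangentLip {n : ℕ} {L : ℝ} (c : ClosedC1 n L) (C : ℝ) : Prop :=
  ∀ x y : ℝ, x ≤ y →
    ‖‖c.fd y‖⁻¹ • c.fd y - ‖c.fd x‖⁻¹ • c.fd x‖ ≤ C * ∫ t in x..y, ‖c.fd t‖

/-- Pointwise geometric focal distance `F_g(γ(s))` of the curve `f` with domain `D`. -/
def FgPt {n : ℕ} (f fd : ℝ → Euc n) (D : Set ℝ) (s : ℝ) : ℝ :=
  sInf {r : ℝ | 0 < r ∧ f s ∈ closure (Odisk (f s) (fd s) r ∩ (f '' D))}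

end

section CurvatureBound

variable {E : Type*} [NormedAddCommGroup E] [InnerProductSpace ℝ E]

open InnerProductGeometry

lemma angle_eq_two_mul_arcsin {u v : E} (hu : ‖u‖ = 1) (hv : ‖v‖ = 1) :
    angle u v = 2 * Real.arcsin (‖u - v‖ / 2) := by
  have h0 := angle_nonneg u v
  have hpi := angle_le_pi u v
  have hcos : ⟪u, v⟫ = Real.cos (angle u v) := by rw [cos_angle, hu, hv]; simp
  have hsin : 0 ≤ Real.sin (angle u v / 2) :=
    Real.sin_nonneg_of_nonneg_of_le_pi (by linarith) (by linarith)
  have hsq : ‖u - v‖ ^ 2 = (2 * Real.sin (angle u v / 2)) ^ 2 := by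
    rw [norm_sub_sq_real, hu, hv, hcos, mul_pow, Real.sin_sq_eq_half_sub,
      mul_div_cancel₀ _ two_ne_zero]
    ring
  have hnorm := (pow_left_inj₀ (norm_nonneg _) (by linarith) two_ne_zero).1 hsq
  rw [hnorm, mul_div_cancel_left₀ _ two_ne_zero,
    Real.arcsin_sin (by linarith [Real.pi_pos]) (by linarith)]
  ring

lemma exists_two_mul_arcsin_half_le {ε : ℝ} (hε : 0 < ε) :
    ∃ δ > 0, ∀ c, 0 ≤ c → c < δ → 2 * Real.arcsin (c / 2) ≤ (1 + ε) * c := by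
  have h := Real.hasDerivAt_arcsin (x := 0) (by norm_num) (by norm_num)
  rw [hasDerivAt_iff_isLittleO] at h
  obtain ⟨δ, hδ, H⟩ := Metric.eventually_nhds_iff.1 (h.def hε)
  refine ⟨δ, hδ, fun c hc hcδ => ?_⟩
  have h1 := H (y := c / 2) (by
    rw [Real.dist_eq, sub_zero, abs_of_nonneg (by linarith)]; linarith)
  simp only [Real.arcsin_zero, sub_zero, smul_eq_mul, Real.norm_eq_abs] at h1
  rw [abs_of_nonneg (by linarith : 0 ≤ c / 2)] at h1
  have h2 := (abs_le.1 h1).2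
  norm_num at h2
  linarith

/-- `f` is a curve with unit tangent field `T`, speed `V` and arclength `σ`, whose tangent field
is `κ`-Lipschitz with respect to arclength. -/
structure HasCurvatureLE (f T : ℝ → E) (σ V : ℝ → ℝ) (κ : ℝ) : Prop where
  hasDerivAt : ∀ t, HasDerivAt f (V t • T t) t
  hasDerivAt_arc : ∀ t, HasDerivAt σ (V t) t
  speed_pos : ∀ t, 0 < V t
  norm_tangent : ∀ t, ‖T t‖ = 1
  lipschitz : ∀ x y, x ≤ y → ‖T y - T x‖ ≤ κ * (σ y - σ x)

namespace HasCurvatureLE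

variable {f T : ℝ → E} {σ V : ℝ → ℝ} {κ : ℝ}

lemma reverse (h : HasCurvatureLE f T σ V κ) :
    HasCurvatureLE (fun t => f (-t)) (fun t => -T (-t)) (fun t => -σ (-t)) (fun t => V (-t)) κ where
  hasDerivAt t := by
    have := (h.hasDerivAt (-t)).scomp t (hasDerivAt_neg t)
    simpa [Function.comp_def] using this
  hasDerivAt_arc t := by
    have := ((h.hasDerivAt_arc (-t)).scomp t (hasDerivAt_neg t)).fun_neg
    simpa [Function.comp_def] using this
  speed_pos t := h.speed_pos _
  norm_tangent t := by rw [norm_neg, h.norm_tangent]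
  lipschitz x y hxy := by
    have := h.lipschitz (-y) (-x) (by linarith)
    rw [show -T (-y) - -T (-x) = T (-x) - T (-y) by abel]
    linarith

lemma strictMono_arc (h : HasCurvatureLE f T σ V κ) : StrictMono σ :=
  strictMono_of_deriv_pos fun t => by rw [(h.hasDerivAt_arc t).deriv]; exact h.speed_pos t

lemma continuous_arc (h : HasCurvatureLE f T σ V κ) : Continuous σ :=
  continuous_iff_continuousAt.2 fun t => (h.hasDerivAt_arc t).continuousAt

lemma continuous_curve (h : HasCurvatureLE f T σ V κ) : Continuous f :=
  continuous_iff_continuousAt.2 fun t => (h.hasDerivAt t).continuousAt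

lemma continuous_tangent (h : HasCurvatureLE f T σ V κ) : Continuous T := by
  refine continuous_iff_continuousAt.2 fun t => ?_
  rw [ContinuousAt, tendsto_iff_norm_sub_tendsto_zero]
  have hb : ∀ u, ‖T u - T t‖ ≤ |κ * (σ u - σ t)| := by
    intro u
    rcases le_total t u with htu | htu
    · exact (h.lipschitz t u htu).trans (le_abs_self _)
    · rw [norm_sub_rev]
      refine (h.lipschitz u t htu).trans ?_
      rw [show κ * (σ t - σ u) = -(κ * (σ u - σ t)) by ring]
      exact neg_le_abs _
  refine squeeze_zero (fun _ => norm_nonneg _) hb ?_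
  have hc : Continuous fun u => |κ * (σ u - σ t)| :=
    (continuous_const.mul (h.continuous_arc.sub continuous_const)).abs
  simpa using hc.tendsto t

lemma hasDerivAt_inner (h : HasCurvatureLE f T σ V κ) (v : E) (t : ℝ) :
    HasDerivAt (fun t => ⟪f t, v⟫) (V t * ⟪T t, v⟫) t := by
  have := (h.hasDerivAt t).inner ℝ (hasDerivAt_const t v)
  simpa [real_inner_smul_left] using this

lemma angle_le (h : HasCurvatureLE f T σ V κ) {x y : ℝ} (hxy : x ≤ y) :
    angle (T x) (T y) ≤ κ * (σ y - σ x) := by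
  have hne : ∀ t, T t ≠ 0 := fun t ht => by simpa [ht] using h.norm_tangent t
  have key : ∀ ε > 0, angle (T x) (T y) ≤ (1 + ε) * (κ * (σ y - σ x)) := by
    intro ε hε
    obtain ⟨δ, hδ, H⟩ := exists_two_mul_arcsin_half_le hε
    let S : Set ℝ := {t | angle (T x) (T t) ≤ (1 + ε) * (κ * (σ t - σ x))}
    have hS : IsClosed S := by
      refine isClosed_le ?_ ?_
      · refine continuous_iff_continuousAt.2 fun t => ?_
        exact (continuousAt_angle (x := (T x, T t)) (hne x) (hne t)).comp
          (f := fun u => (T x, T u))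
          (continuousAt_const.prodMk h.continuous_tangent.continuousAt)
      · exact continuous_const.mul (continuous_const.mul (h.continuous_arc.sub continuous_const))
    have hsub : Icc x y ⊆ S := by
      refine (hS.inter isClosed_Icc).Icc_subset_of_forall_exists_gt ?_ ?_
      · simp [S, angle_self (hne x)]
      · rintro t ⟨ht, -⟩ b hb
        have hc : Continuous fun u => κ * (σ u - σ t) :=
          continuous_const.mul (h.continuous_arc.sub continuous_const)
        have hev : ∀ᶠ u in 𝓝 t, κ * (σ u - σ t) < δ :=
          hc.continuousAt.eventually_lt continuousAt_const (by simpa using hδ)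
        have hev' : ∀ᶠ u in 𝓝[>] t, κ * (σ u - σ t) < δ ∧ u ∈ Ioc t b :=
          (hev.filter_mono nhdsWithin_le_nhds).and (Ioc_mem_nhdsGT hb)
        obtain ⟨u, hu, hub⟩ := hev'.exists
        refine ⟨u, ?_, hub⟩
        have hl := h.lipschitz t u hub.1.le
        rw [norm_sub_rev] at hl
        have ha : angle (T t) (T u) ≤ (1 + ε) * (κ * (σ u - σ t)) := by
          rw [angle_eq_two_mul_arcsin (h.norm_tangent t) (h.norm_tangent u)]
          refine (H _ (norm_nonneg _) (hl.trans_lt hu)).trans ?_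
          gcongr
        have htri := angle_le_angle_add_angle (T x) (T t) (T u)
        change angle (T x) (T u) ≤ (1 + ε) * (κ * (σ u - σ x))
        have ht' : angle (T x) (T t) ≤ (1 + ε) * (κ * (σ t - σ x)) := ht
        linarith
    exact hsub (right_mem_Icc.2 hxy)
  have hc : Continuous fun ε : ℝ => (1 + ε) * (κ * (σ y - σ x)) := by fun_prop
  have ht : Tendsto (fun ε : ℝ => (1 + ε) * (κ * (σ y - σ x))) (𝓝[>] 0)
      (𝓝 (κ * (σ y - σ x))) := by
    simpa using (hc.tendsto 0).mono_left nhdsWithin_le_nhds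
  exact ge_of_tendsto ht (eventually_mem_nhdsWithin.mono fun ε hε => key ε hε)

lemma inner_tangent (h : HasCurvatureLE f T σ V κ) (s : ℝ) {v : E} (hv : ‖v‖ = 1) :
    ⟪T s, v⟫ = Real.cos (angle (T s) v) := by
  rw [cos_angle, h.norm_tangent, hv]; simp

lemma cos_le_inner_tangent (h : HasCurvatureLE f T σ V κ) {x y : ℝ} (hxy : x ≤ y)
    (hπ : κ * (σ y - σ x) ≤ Real.pi) : Real.cos (κ * (σ y - σ x)) ≤ ⟪T x, T y⟫ := by
  rw [h.inner_tangent x (h.norm_tangent y)]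
  exact Real.cos_le_cos_of_nonneg_of_le_pi (angle_nonneg _ _) hπ (h.angle_le hxy)

/-- Schur's comparison: a chord is at least as long as the chord of the circle of curvature `κ`. -/
lemma two_mul_sin_le_norm (h : HasCurvatureLE f T σ V κ) (hκ : 0 < κ) {x y : ℝ} (hxy : x ≤ y)
    (hπ : κ * (σ y - σ x) ≤ Real.pi) :
    2 * Real.sin (κ * (σ y - σ x) / 2) ≤ κ * ‖f y - f x‖ := by
  have hσ := h.strictMono_arc.monotone hxy
  obtain ⟨m, hm, hσm⟩ : (σ x + σ y) / 2 ∈ σ '' Icc x y :=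
    intermediate_value_Icc hxy h.continuous_arc.continuousOn ⟨by linarith, by linarith⟩
  let g : ℝ → ℝ := fun s => κ * ⟪f s, T m⟫ - Real.sin (κ * (σ s - σ m))
  have hg : ∀ s, HasDerivAt g
      (κ * (V s * ⟪T s, T m⟫) - Real.cos (κ * (σ s - σ m)) * (κ * V s)) s := fun s =>
    ((h.hasDerivAt_inner (T m) s).const_mul κ).sub
      ((((h.hasDerivAt_arc s).sub_const (σ m)).const_mul κ).sin)
  have hmono : MonotoneOn g (Icc x y) := by
    refine monotoneOn_of_deriv_nonneg (convex_Icc x y)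
      (fun s _ => (hg s).continuousAt.continuousWithinAt)
      (fun s _ => (hg s).differentiableAt.differentiableWithinAt) fun s hs => ?_
    rw [interior_Icc] at hs
    rw [(hg s).deriv]
    have hcos : Real.cos (κ * (σ s - σ m)) ≤ ⟪T s, T m⟫ := by
      have hsx := h.strictMono_arc.monotone hs.1.le
      have hsy := h.strictMono_arc.monotone hs.2.le
      rcases le_total s m with hsm | hsm
      · rw [← Real.cos_neg, show -(κ * (σ s - σ m)) = κ * (σ m - σ s) by ring]
        exact h.cos_le_inner_tangent hsm
          (le_trans (mul_le_mul_of_nonneg_left (by linarith) hκ.le) hπ)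
      · rw [real_inner_comm]
        exact h.cos_le_inner_tangent hsm
          (le_trans (mul_le_mul_of_nonneg_left (by linarith) hκ.le) hπ)
    have := mul_nonneg (mul_pos hκ (h.speed_pos s)).le (sub_nonneg.2 hcos)
    linarith
  have hle := hmono (left_mem_Icc.2 hxy) (right_mem_Icc.2 hxy) hxy
  simp only [g] at hle
  rw [show κ * (σ x - σ m) = -(κ * (σ y - σ x) / 2) by rw [hσm]; ring,
    show κ * (σ y - σ m) = κ * (σ y - σ x) / 2 by rw [hσm]; ring, Real.sin_neg] at hle
  have hcs := real_inner_le_norm (f y - f x) (T m)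
  rw [h.norm_tangent, mul_one, inner_sub_left] at hcs
  have := mul_le_mul_of_nonneg_left hcs hκ.le
  linarith

/-- The chord makes an angle of at most half the total curvature bound with the initial tangent. -/
lemma cos_mul_inner_le (h : HasCurvatureLE f T σ V κ) (hκ : 0 < κ) {x y : ℝ} (hxy : x ≤ y)
    (hπ : κ * (σ y - σ x) ≤ Real.pi) {w : E} (hw : ‖w‖ = 1) (hwT : ⟪w, T x⟫ = 0) :
    Real.cos (κ * (σ y - σ x) / 2) * ⟪f y - f x, w⟫ ≤
      Real.sin (κ * (σ y - σ x) / 2) * ⟪f y - f x, T x⟫ := by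
  have hσ := h.strictMono_arc.monotone hxy
  have hκσ := mul_nonneg hκ.le (sub_nonneg.2 hσ)
  set β := κ * (σ y - σ x) / 2 with hβ
  set v : E := Real.cos β • w - Real.sin β • T x with hv
  have hwT' : ⟪T x, w⟫ = 0 := by rw [real_inner_comm, hwT]
  have hTT : ⟪T x, T x⟫ = 1 := by rw [real_inner_self_eq_norm_sq, h.norm_tangent]; norm_num
  have hww : ⟪w, w⟫ = 1 := by rw [real_inner_self_eq_norm_sq, hw]; norm_num
  have hv1 : ‖v‖ = 1 := by
    have : ‖v‖ ^ 2 = 1 := by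
      rw [← real_inner_self_eq_norm_sq, hv]
      simp only [inner_sub_left, inner_sub_right, real_inner_smul_left, real_inner_smul_right,
        hwT, hwT', hTT, hww]
      linarith [Real.sin_sq_add_cos_sq β]
    exact (pow_eq_one_iff_of_nonneg (norm_nonneg _) two_ne_zero).1 this
  have hangle : angle (T x) v = β + Real.pi / 2 := by
    have : Real.cos (angle (T x) v) = Real.cos (β + Real.pi / 2) := by
      rw [← h.inner_tangent x hv1, Real.cos_add_pi_div_two, hv]
      simp [inner_sub_right, real_inner_smul_right, hwT', h.norm_tangent]
    exact Real.injOn_cos ⟨angle_nonneg _ _, angle_le_pi _ _⟩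
      ⟨by linarith [Real.pi_pos], by linarith⟩ this
  let g : ℝ → ℝ := fun s => κ * ⟪f s, v⟫ + Real.cos (κ * (σ s - σ x) - β)
  have hg : ∀ s, HasDerivAt g
      (κ * (V s * ⟪T s, v⟫) + -Real.sin (κ * (σ s - σ x) - β) * (κ * V s)) s := fun s =>
    ((h.hasDerivAt_inner v s).const_mul κ).add
      ((((h.hasDerivAt_arc s).sub_const (σ x)).const_mul κ).sub_const β).cos
  have hanti : AntitoneOn g (Icc x y) := by
    refine antitoneOn_of_deriv_nonpos (convex_Icc x y)
      (fun s _ => (hg s).continuousAt.continuousWithinAt)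
      (fun s _ => (hg s).differentiableAt.differentiableWithinAt) fun s hs => ?_
    rw [interior_Icc] at hs
    rw [(hg s).deriv]
    have hsy := mul_le_mul_of_nonneg_left (sub_le_sub_right
      (h.strictMono_arc.monotone hs.2.le) (σ x)) hκ.le
    have htri := angle_le_angle_add_angle (T x) (T s) v
    have hxs := h.angle_le hs.1.le
    have hsin : ⟪T s, v⟫ ≤ Real.sin (κ * (σ s - σ x) - β) := by
      rw [h.inner_tangent s hv1, ← Real.cos_pi_div_two_sub]
      exact Real.cos_le_cos_of_nonneg_of_le_pi (by linarith) (angle_le_pi _ _) (by linarith)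
    have := mul_nonneg (mul_pos hκ (h.speed_pos s)).le (sub_nonneg.2 hsin)
    linarith
  have hle := hanti (left_mem_Icc.2 hxy) (right_mem_Icc.2 hxy) hxy
  simp only [g] at hle
  rw [show κ * (σ y - σ x) - β = β by rw [hβ]; ring,
    show κ * (σ x - σ x) - β = -β by ring, Real.cos_neg, add_le_add_iff_right] at hle
  have hle' := le_of_mul_le_mul_left hle hκ
  simp only [hv, inner_sub_right, real_inner_smul_right] at hle'
  simp only [inner_sub_left]
  linarith

/-- Arcs of total curvature at most `π` stay outside the balls of radius `1 / κ` tangent to the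
curve at their initial point. -/
lemma two_mul_inner_le (h : HasCurvatureLE f T σ V κ) (hκ : 0 < κ) {x y : ℝ} (hxy : x ≤ y)
    (hπ : κ * (σ y - σ x) ≤ Real.pi) {w : E} (hw : ‖w‖ = 1) (hwT : ⟪w, T x⟫ = 0) :
    2 * ⟪f y - f x, w⟫ ≤ κ * ‖f y - f x‖ ^ 2 := by
  have hσ := h.strictMono_arc.monotone hxy
  have hκσ := mul_nonneg hκ.le (sub_nonneg.2 hσ)
  have hsin := h.two_mul_sin_le_norm hκ hxy hπ
  have hcone := h.cos_mul_inner_le hκ hxy hπ hw hwT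
  set β := κ * (σ y - σ x) / 2 with hβ
  set X := f y - f x with hX
  have hs0 : 0 ≤ Real.sin β := Real.sin_nonneg_of_nonneg_of_le_pi (by linarith) (by linarith)
  have hc0 : 0 ≤ Real.cos β := Real.cos_nonneg_of_mem_Icc ⟨by linarith, by linarith⟩
  rcases le_or_gt ⟪X, w⟫ 0 with hp | hp
  · have : 0 ≤ κ * ‖X‖ ^ 2 := by positivity
    linarith
  have hpq : ⟪X, w⟫ ^ 2 + ⟪X, T x⟫ ^ 2 ≤ ‖X‖ ^ 2 := by
    have hwT' : ⟪T x, w⟫ = 0 := by rw [real_inner_comm, hwT]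
    have hTT : ⟪T x, T x⟫ = 1 := by rw [real_inner_self_eq_norm_sq, h.norm_tangent]; norm_num
    have hww : ⟪w, w⟫ = 1 := by rw [real_inner_self_eq_norm_sq, hw]; norm_num
    have hnn := real_inner_self_nonneg (x := X - ⟪X, w⟫ • w - ⟪X, T x⟫ • T x)
    simp only [inner_sub_left, inner_sub_right, real_inner_smul_left, real_inner_smul_right,
      hwT, hwT', hTT, hww, real_inner_self_eq_norm_sq X, real_inner_comm X w,
      real_inner_comm X (T x)] at hnn
    linarith
  have hp2 : ⟪X, w⟫ ≤ Real.sin β * ‖X‖ := by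
    have hsq := pow_le_pow_left₀ (mul_nonneg hc0 hp.le) hcone 2
    refine le_of_sq_le_sq ?_ (mul_nonneg hs0 (norm_nonneg _))
    have h1 := mul_le_mul_of_nonneg_left hpq (sq_nonneg (Real.sin β))
    have h2 := Real.sin_sq_add_cos_sq β
    have h3 : ⟪X, w⟫ ^ 2 = (Real.sin β ^ 2 + Real.cos β ^ 2) * ⟪X, w⟫ ^ 2 := by rw [h2, one_mul]
    rw [mul_pow] at hsq ⊢
    rw [h3]
    nlinarith
  have := mul_le_mul_of_nonneg_right hsin (norm_nonneg X)
  nlinarith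

/-- On a closed curve of length `ℓ`, two points at distance less than `2 / κ` whose two connecting
arcs both have total curvature bound at least `π` force a double critical pair with the same
properties. -/
lemma exists_double_critical (h : HasCurvatureLE f T σ V κ) (hκ : 0 < κ) {L ℓ : ℝ} (hL : 0 < L)
    (hf : ∀ x, f (x + L) = f x) (hσ : ∀ x, σ (x + L) = σ x + ℓ) {s t : ℝ}
    (hst : κ * (σ t - σ s) ∈ Icc Real.pi (κ * ℓ - Real.pi)) (hlt : κ * ‖f t - f s‖ < 2) :
    ∃ s' ∈ Icc 0 L, ∃ t' ∈ Icc s' (s' + L),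
      κ * (σ t' - σ s') ∈ Icc Real.pi (κ * ℓ - Real.pi) ∧ κ * ‖f t' - f s'‖ < 2 ∧
        ⟪f t' - f s', T s'⟫ = 0 ∧ ⟪f t' - f s', T t'⟫ = 0 := by
  have hfc := h.continuous_curve
  have hσc := h.continuous_arc
  have hmem : ∀ x u, κ * (σ (x + u) - σ x) ∈ Icc Real.pi (κ * ℓ - Real.pi) → u ∈ Icc 0 L := by
    intro x u hu
    have h1 : σ x < σ (x + u) := by
      have := pos_of_mul_pos_right (Real.pi_pos.trans_le hu.1) hκ.le
      linarith
    have h2 : σ (x + u) < σ (x + L) := by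
      have : κ * (σ (x + u) - σ x) < κ * ℓ := by linarith [hu.2, Real.pi_pos]
      have := lt_of_mul_lt_mul_left this hκ.le
      rw [hσ]
      linarith
    rw [h.strictMono_arc.lt_iff_lt] at h1 h2
    exact ⟨by linarith, by linarith⟩
  let P : Set (ℝ × ℝ) := (Icc 0 L ×ˢ Icc 0 L) ∩
    {p | κ * (σ (p.1 + p.2) - σ p.1) ∈ Icc Real.pi (κ * ℓ - Real.pi)}
  have hP : IsCompact P := (isCompact_Icc.prod isCompact_Icc).inter_right
    (isClosed_Icc.preimage (by fun_prop))
  have hshift : ∀ x u, κ * (σ (x + u) - σ x) ∈ Icc Real.pi (κ * ℓ - Real.pi) →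
      ∃ x', (x', u) ∈ P ∧ ‖f (x' + u) - f x'‖ = ‖f (x + u) - f x‖ := by
    intro x u hu
    obtain ⟨k, hk, -⟩ := existsUnique_add_zsmul_mem_Ico hL x 0
    rw [zero_add] at hk
    have hperσ : Function.Periodic (fun x => κ * (σ (x + u) - σ x)) L := fun x => by
      simp only [add_right_comm x L u, hσ]; ring
    have hperf : Function.Periodic (fun x => ‖f (x + u) - f x‖) L := fun x => by
      simp only [add_right_comm x L u, hf]
    refine ⟨x + k • L, ⟨⟨Ico_subset_Icc_self hk, hmem x u hu⟩, ?_⟩, hperf.zsmul k x⟩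
    change (fun x => κ * (σ (x + u) - σ x)) (x + k • L) ∈ Icc Real.pi (κ * ℓ - Real.pi)
    rw [hperσ.zsmul k x]
    exact hu
  obtain ⟨x₁, hx₁, -⟩ := hshift s (t - s) (by simpa using hst)
  obtain ⟨⟨s₀, u₀⟩, hp, hmin⟩ := hP.exists_isMinOn ⟨_, hx₁⟩
    (f := fun p : ℝ × ℝ => ‖f (p.1 + p.2) - f p.1‖) (by fun_prop)
  obtain ⟨⟨hs₀, hu₀⟩, hψ⟩ := hp
  obtain ⟨t₀, rfl⟩ : ∃ t₀, u₀ = t₀ - s₀ := ⟨s₀ + u₀, by ring⟩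
  simp only [add_sub_cancel, mem_ofPred_eq] at hψ hs₀ hu₀ hmin
  have hmin' : ∀ x y, κ * (σ y - σ x) ∈ Icc Real.pi (κ * ℓ - Real.pi) →
      ‖f t₀ - f s₀‖ ≤ ‖f y - f x‖ := by
    intro x y hxy
    obtain ⟨x', hx', hx''⟩ := hshift x (y - x) (by simpa using hxy)
    have := isMinOn_iff.1 hmin _ hx'
    simp only [add_sub_cancel] at this hx''
    rwa [hx''] at this
  have hlt₀ : κ * ‖f t₀ - f s₀‖ < 2 :=
    (mul_le_mul_of_nonneg_left (hmin' s t hst) hκ.le).trans_lt hlt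
  have hne1 : κ * (σ t₀ - σ s₀) ≠ Real.pi := by
    intro he
    have := h.two_mul_sin_le_norm hκ (x := s₀) (y := t₀) (by linarith [hu₀.1]) he.le
    rw [he, Real.sin_pi_div_two] at this
    linarith
  have hne2 : κ * (σ t₀ - σ s₀) ≠ κ * ℓ - Real.pi := by
    intro he
    have he' : κ * (σ (s₀ + L) - σ t₀) = Real.pi := by rw [hσ]; linarith
    have := h.two_mul_sin_le_norm hκ (x := t₀) (y := s₀ + L) (by linarith [hu₀.2]) he'.le
    rw [he', Real.sin_pi_div_two, hf, norm_sub_rev] at this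
    linarith
  have hIoo : κ * (σ t₀ - σ s₀) ∈ Ioo Real.pi (κ * ℓ - Real.pi) :=
    ⟨lt_of_le_of_ne hψ.1 hne1.symm, lt_of_le_of_ne hψ.2 hne2⟩
  have hcrit1 : IsLocalMin (fun x => ‖f t₀ - f x‖ ^ 2) s₀ := by
    have hc : Continuous fun x => κ * (σ t₀ - σ x) := by fun_prop
    filter_upwards [hc.continuousAt.eventually_mem (isOpen_Ioo.mem_nhds hIoo)] with x hx
    exact pow_le_pow_left₀ (norm_nonneg _) (hmin' x t₀ (Ioo_subset_Icc_self hx)) 2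
  have hcrit2 : IsLocalMin (fun y => ‖f y - f s₀‖ ^ 2) t₀ := by
    have hc : Continuous fun y => κ * (σ y - σ s₀) := by fun_prop
    filter_upwards [hc.continuousAt.eventually_mem (isOpen_Ioo.mem_nhds hIoo)] with y hy
    exact pow_le_pow_left₀ (norm_nonneg _) (hmin' s₀ y (Ioo_subset_Icc_self hy)) 2
  have hd1 := hcrit1.hasDerivAt_eq_zero ((h.hasDerivAt s₀).const_sub (f t₀)).norm_sq
  have hd2 := hcrit2.hasDerivAt_eq_zero ((h.hasDerivAt t₀).sub_const (f s₀)).norm_sq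
  refine ⟨s₀, hs₀, t₀, ⟨by linarith [hu₀.1], by linarith [hu₀.2]⟩, hψ, hlt₀, ?_, ?_⟩
  · simpa [inner_neg_right, real_inner_smul_right, (h.speed_pos s₀).ne'] using hd1
  · simpa [real_inner_smul_right, (h.speed_pos t₀).ne'] using hd2

/-- If no double critical pair at distance less than `2 / κ` has both arcs of total curvature bound
at least `π`, the closed curve stays outside all its tangent balls of radius `1 / κ`. -/
lemma two_mul_inner_le_of_closed (h : HasCurvatureLE f T σ V κ) (hκ : 0 < κ) {L ℓ : ℝ} (hL : 0 < L)
    (hf : ∀ x, f (x + L) = f x) (hT : ∀ x, T (x + L) = T x) (hσ : ∀ x, σ (x + L) = σ x + ℓ)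
    (hcrit : ∀ s ∈ Icc (0 : ℝ) L, ∀ t ∈ Icc s (s + L),
      κ * (σ t - σ s) ∈ Icc Real.pi (κ * ℓ - Real.pi) → κ * ‖f t - f s‖ < 2 →
        ⟪f t - f s, T s⟫ = 0 → ⟪f t - f s, T t⟫ ≠ 0)
    {s t : ℝ} {w : E} (hw : ‖w‖ = 1) (hwT : ⟪w, T s⟫ = 0) :
    2 * ⟪f t - f s, w⟫ ≤ κ * ‖f t - f s‖ ^ 2 := by
  obtain ⟨k, hk, -⟩ := existsUnique_add_zsmul_mem_Ico hL t s
  have hft : f (t + k • L) = f t := Function.Periodic.zsmul (f := f) hf k t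
  rw [← hft]
  generalize t + k • L = t at hk
  rcases le_total (κ * (σ t - σ s)) Real.pi with h1 | h1
  · exact h.two_mul_inner_le hκ hk.1 h1 hw hwT
  rcases le_total (κ * ℓ - Real.pi) (κ * (σ t - σ s)) with h2 | h2
  · have := h.reverse.two_mul_inner_le hκ (x := -(s + L)) (y := -t) (by linarith [hk.2])
      (by simp only [neg_neg, hσ]; linarith) hw (by simpa [inner_neg_right, hT] using hwT)
    simpa only [neg_neg, hf] using this
  · by_contra! hcon
    have hcs := real_inner_le_norm (f t - f s) w
    rw [hw, mul_one] at hcs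
    have hpos : 0 < ‖f t - f s‖ := by
      have h0 : 0 ≤ κ * ‖f t - f s‖ ^ 2 := by positivity
      linarith
    have hlt : κ * ‖f t - f s‖ < 2 := by
      refine lt_of_mul_lt_mul_right ?_ hpos.le
      nlinarith
    obtain ⟨s', hs', t', ht', h3, h4, h5, h6⟩ :=
      h.exists_double_critical hκ hL hf hσ ⟨h1, h2⟩ hlt
    exact hcrit s' hs' t' ht' h3 h4 h5 h6

end HasCurvatureLE

lemma norm_sub_smul_lt_iff {X w : E} {r : ℝ} (hr : 0 < r) (hw : ‖w‖ = 1) :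
    ‖X - r • w‖ < r ↔ ‖X‖ ^ 2 < 2 * r * ⟪X, w⟫ := by
  rw [← pow_lt_pow_iff_left₀ (norm_nonneg _) hr.le two_ne_zero, norm_sub_sq_real,
    real_inner_smul_right, norm_smul, hw, mul_one, Real.norm_of_nonneg hr.le]
  constructor <;> intro h <;> linarith

/-- If the point `X` is outside all balls of radius `r` tangent to `v` at the origin, then the
angle between `X` and `v` is controlled by `‖X‖`. -/
lemma angle_le_arcsin {X v : E} {r : ℝ} (hr : 0 < r) (hv : ‖v‖ = 1) (hX : 0 < ⟪X, v⟫)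
    (hball : ∀ w : E, ‖w‖ = 1 → ⟪w, v⟫ = 0 → 2 * r * ⟪X, w⟫ ≤ ‖X‖ ^ 2) :
    angle X v ≤ Real.arcsin (‖X‖ / (2 * r)) := by
  have hX0 : 0 < ‖X‖ := norm_pos_iff.2 fun h => by simp [h] at hX
  have hvv : ⟪v, v⟫ = 1 := by rw [real_inner_self_eq_norm_sq, hv]; norm_num
  set p := X - ⟪X, v⟫ • v with hp
  have hpv : ⟪p, v⟫ = 0 := by
    rw [hp, inner_sub_left, real_inner_smul_left, hvv]; ring
  have hXp : ⟪X, p⟫ = ‖p‖ ^ 2 := by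
    have : ⟪p, p⟫ = ⟪X, p⟫ := by
      conv_lhs => rw [hp, inner_sub_left, real_inner_smul_left, ← hp, real_inner_comm p v, hpv]
      rw [mul_zero, sub_zero]
    rw [← this, real_inner_self_eq_norm_sq]
  have hpn : ‖p‖ ^ 2 = ⟪X, X⟫ * ⟪v, v⟫ - ⟪X, v⟫ * ⟪X, v⟫ := by
    rw [← hXp, hp, inner_sub_right, real_inner_smul_right, hvv, mul_one]
  have hpX : ‖p‖ ≤ ‖X‖ ^ 2 / (2 * r) := by
    rcases eq_or_ne p 0 with h0 | h0
    · rw [h0, norm_zero]; positivity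
    have hp0 : ‖p‖ ≠ 0 := norm_ne_zero_iff.2 h0
    have := hball (‖p‖⁻¹ • p) (norm_smul_inv_norm h0)
      (by rw [real_inner_smul_left, hpv, mul_zero])
    rw [real_inner_smul_right, hXp, sq ‖p‖, inv_mul_cancel_left₀ hp0] at this
    rw [le_div_iff₀ (by positivity)]
    linarith
  have hsin : Real.sin (angle X v) ≤ ‖X‖ / (2 * r) := by
    have h1 := sin_angle_mul_norm_mul_norm X v
    rw [hv, mul_one, ← hpn, Real.sqrt_sq (norm_nonneg _)] at h1
    refine le_of_mul_le_mul_right ?_ hX0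
    rw [h1]
    refine hpX.trans (le_of_eq ?_)
    ring
  have hle : angle X v ≤ Real.pi / 2 := by
    rw [angle, Real.arccos_le_pi_div_two]
    positivity
  rw [← Real.arcsin_sin (by linarith [angle_nonneg X v, Real.pi_pos]) hle]
  exact Real.monotone_arcsin hsin

end CurvatureBound

namespace Knot

open InnerProductGeometry

variable {n : ℕ} (γ : Knot n)

lemma continuous_fd : Continuous γ.fd := γ.lipd.choose_spec.continuous

lemma continuous_f : Continuous γ.f :=
  continuous_iff_continuousAt.2 fun t => (γ.deriv t).continuousAt

lemma angle_fd_le {r x y : ℝ} (hr : 0 < r)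
    (hball : ∀ s t : ℝ, ∀ w : Euc n, ‖w‖ = 1 → ⟪w, γ.fd s⟫ = 0 → r ≤ ‖γ.f t - γ.f s - r • w‖)
    (hxy : x < y) (hpos : ∀ u ∈ Icc x y, ∀ v ∈ Icc x y, 0 < ⟪γ.fd u, γ.fd v⟫) :
    angle (γ.fd x) (γ.fd y) ≤ 2 * Real.arcsin ((y - x) / r / 2) := by
  set X := γ.f y - γ.f x with hX
  have hxm := left_mem_Icc.2 hxy.le
  have hym := right_mem_Icc.2 hxy.le
  have hinner : ∀ v ∈ Icc x y, 0 < ⟪X, γ.fd v⟫ := by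
    intro v hv
    have hd : ∀ s, HasDerivAt (fun t => ⟪γ.f t, γ.fd v⟫) ⟪γ.fd s, γ.fd v⟫ s := fun s => by
      simpa using (γ.deriv s).inner ℝ (hasDerivAt_const s (γ.fd v))
    have hmono : StrictMonoOn (fun t => ⟪γ.f t, γ.fd v⟫) (Icc x y) :=
      strictMonoOn_of_deriv_pos (convex_Icc x y)
        (fun s _ => (hd s).continuousAt.continuousWithinAt) fun s hs => by
          rw [(hd s).deriv]
          exact hpos s (interior_subset hs) v hv
    have := hmono hxm hym hxy
    rw [hX, inner_sub_left]
    exact sub_pos.2 this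
  have hXle : ‖X‖ ≤ y - x := by
    have := (convex_univ (𝕜 := ℝ) (E := ℝ)).norm_image_sub_le_of_norm_hasDerivWithin_le
      (fun s _ => (γ.deriv s).hasDerivWithinAt) (fun s _ => (γ.unit s).le)
      (mem_univ x) (mem_univ y)
    rwa [one_mul, Real.norm_of_nonneg (by linarith)] at this
  have hout : ∀ s t : ℝ, ∀ w : Euc n, ‖w‖ = 1 → ⟪w, γ.fd s⟫ = 0 →
      2 * r * ⟪γ.f t - γ.f s, w⟫ ≤ ‖γ.f t - γ.f s‖ ^ 2 := fun s t w hw hws =>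
    not_lt.1 fun h => (hball s t w hw hws).not_gt ((norm_sub_smul_lt_iff hr hw).2 h)
  have h1 : angle X (γ.fd x) ≤ Real.arcsin (‖X‖ / (2 * r)) :=
    angle_le_arcsin hr (γ.unit x) (hinner x hxm) (hout x y)
  have h2 : angle X (γ.fd y) ≤ Real.arcsin (‖X‖ / (2 * r)) := by
    refine angle_le_arcsin hr (γ.unit y) (hinner y hym) fun w hw hwy => ?_
    have := hout y x (-w) (by rwa [norm_neg]) (by rw [inner_neg_left, hwy, neg_zero])
    rwa [← neg_sub, ← hX, inner_neg_neg, norm_neg] at this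
  have htri := angle_le_angle_add_angle (γ.fd x) X (γ.fd y)
  rw [angle_comm (γ.fd x) X] at htri
  have h3 : Real.arcsin (‖X‖ / (2 * r)) ≤ Real.arcsin ((y - x) / r / 2) := by
    refine Real.monotone_arcsin ?_
    rw [div_div, mul_comm r 2]
    gcongr
  linarith

lemma supCurv_le {r : ℝ} (hr : 0 < r)
    (hball : ∀ s t : ℝ, ∀ w : Euc n, ‖w‖ = 1 → ⟪w, γ.fd s⟫ = 0 → r ≤ ‖γ.f t - γ.f s - r • w‖) :
    γ.supCurv ≤ r⁻¹ := by
  refine le_of_forall_pos_le_add fun ε hε => ciSup_le fun s => ?_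
  refine csInf_le ⟨0, fun _ h => h.1⟩ ⟨by positivity, ?_⟩
  obtain ⟨δ, hδ, H⟩ := exists_two_mul_arcsin_half_le (mul_pos hε hr)
  obtain ⟨η, hη, hcont⟩ := Metric.continuous_iff.1 γ.continuous_fd s (1 / 2) (by norm_num)
  refine ⟨min η (r * δ / 2), by positivity, ?_⟩
  have main : ∀ x y, x < y → |x - s| < min η (r * δ / 2) → |y - s| < min η (r * δ / 2) →
      angle (γ.fd x) (γ.fd y) ≤ (r⁻¹ + ε) * |x - y| := by
    intro x y hxy hx hy
    rw [lt_min_iff, abs_lt, abs_lt] at hx hy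
    have hnear : ∀ u ∈ Icc x y, ‖γ.fd u - γ.fd s‖ < 1 / 2 := fun u hu => by
      rw [← dist_eq_norm]
      refine hcont u ?_
      rw [Real.dist_eq, abs_lt]
      constructor <;> linarith [hu.1, hu.2]
    have hpos : ∀ u ∈ Icc x y, ∀ v ∈ Icc x y, 0 < ⟪γ.fd u, γ.fd v⟫ := by
      intro u hu v hv
      have huv : ‖γ.fd u - γ.fd v‖ < 1 := by
        have h1 := hnear u hu
        have h2 := hnear v hv
        have := norm_sub_le_norm_sub_add_norm_sub (γ.fd u) (γ.fd s) (γ.fd v)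
        rw [norm_sub_rev (γ.fd s)] at this
        linarith
      have hsq := norm_sub_sq_real (γ.fd u) (γ.fd v)
      rw [γ.unit, γ.unit] at hsq
      nlinarith [norm_nonneg (γ.fd u - γ.fd v)]
    refine (γ.angle_fd_le hr hball hxy hpos).trans ?_
    have hlt : (y - x) / r < δ := by
      rw [div_lt_iff₀ hr]
      linarith
    refine (H _ (div_nonneg (by linarith) hr.le) hlt).trans (le_of_eq ?_)
    rw [abs_of_neg (by linarith)]
    field_simp
    ring
  intro x _ y _ hne hx hy
  rcases lt_or_gt_of_ne hne with h | h
  · exact main x y h hx hy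
  · rw [angle_comm, abs_sub_comm]
    exact main y x h hy hx

lemma RO_le_Fk (hpos : 0 < γ.supCurv) : RO γ.f γ.fd univ ≤ γ.Fk := by
  refine le_of_forall_gt_imp_ge_of_dense fun r hr => ?_
  have hF : 0 < γ.Fk := inv_pos.2 hpos
  have hr0 : 0 < r := hF.trans hr
  by_contra! hcon
  have hle := γ.supCurv_le hr0 fun s t w hw hws => by
    by_contra! hlt
    exact hcon.not_ge (csInf_le ⟨0, fun _ h => h.1.le⟩
      ⟨hr0, s, mem_univ s, t, mem_univ t, w, hw, hws, hlt⟩)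
  have := inv_lt_of_inv_lt₀ hpos hr
  linarith

lemma f_ne {s t : ℝ} (h0 : s < t) (h1 : t < s + γ.L) : γ.f s ≠ γ.f t := by
  intro heq
  obtain ⟨j, hj, -⟩ := existsUnique_add_zsmul_mem_Ico γ.Lpos s 0
  obtain ⟨k, hk, -⟩ := existsUnique_add_zsmul_mem_Ico γ.Lpos t 0
  rw [zero_add] at hj hk
  have hper : ∀ (i : ℤ) x, γ.f (x + i • γ.L) = γ.f x := fun i x =>
    Function.Periodic.zsmul (f := γ.f) γ.per i x
  have := γ.inj hj hk (by rw [hper, hper, heq])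
  simp only [zsmul_eq_mul] at this
  have h2 : t - s = ((j - k : ℤ) : ℝ) * γ.L := by push_cast; linarith
  have hL := γ.Lpos
  have h3 : (0 : ℝ) < ((j - k : ℤ) : ℝ) := pos_of_mul_pos_left (by linarith) hL.le
  have h4 : ((j - k : ℤ) : ℝ) < 1 := lt_of_mul_lt_mul_right (by linarith) hL.le
  norm_cast at h3 h4
  omega

lemma MDC_le {x y : ℝ} (hne : γ.f x ≠ γ.f y) (hx : ⟪γ.f x - γ.f y, γ.fd x⟫ = 0)
    (hy : ⟪γ.f x - γ.f y, γ.fd y⟫ = 0) : MDC γ.f γ.fd ≤ ‖γ.f x - γ.f y‖ :=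
  csInf_le ⟨0, by rintro _ ⟨_, _, _, _, _, rfl⟩; exact norm_nonneg _⟩ ⟨x, y, hne, hx, hy, rfl⟩

end Knot

namespace ClosedC11

variable {n : ℕ} {L : ℝ} (c : ClosedC11 n L)

/-- Arclength of `c` from the parameter `0`. -/
noncomputable def arc (t : ℝ) : ℝ := ∫ u in (0 : ℝ)..t, ‖c.fd u‖

/-- Unit tangent field of `c`. -/
noncomputable def tangent (t : ℝ) : Euc n := ‖c.fd t‖⁻¹ • c.fd t

lemma continuous_speed : Continuous fun t => ‖c.fd t‖ :=
  c.lipd.choose_spec.continuous.norm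

lemma arc_sub (x y : ℝ) : c.arc y - c.arc x = ∫ u in x..y, ‖c.fd u‖ :=
  intervalIntegral.integral_interval_sub_left (c.continuous_speed.intervalIntegrable _ _)
    (c.continuous_speed.intervalIntegrable _ _)

lemma arc_add_period (x : ℝ) : c.arc (x + L) = c.arc x + c.arc L := by
  have hper : Function.Periodic (fun t => ‖c.fd t‖) L := fun t => by simp only [c.perd]
  have h := hper.intervalIntegral_add_eq x 0
  rw [zero_add, ← arc_sub] at h
  change _ = c.arc L at h
  linarith

lemma tangent_add_period (x : ℝ) : c.tangent (x + L) = c.tangent x := by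
  rw [tangent, tangent, c.perd]

lemma inner_tangent_eq_zero {v : Euc n} {t : ℝ} : ⟪v, c.tangent t⟫ = 0 ↔ ⟪v, c.fd t⟫ = 0 := by
  simp [tangent, real_inner_smul_right, c.nz t]

lemma hasCurvatureLE {κ : ℝ} (h : TangentLip c.toClosedC1 κ) :
    HasCurvatureLE c.f c.tangent c.arc (fun t => ‖c.fd t‖) κ where
  hasDerivAt t := by
    rw [tangent, smul_inv_smul₀ (norm_ne_zero_iff.2 (c.nz t))]
    exact c.deriv t
  hasDerivAt_arc t := (c.continuous_speed.integral_hasStrictDerivAt 0 t).hasDerivAt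
  speed_pos t := norm_pos_iff.2 (c.nz t)
  norm_tangent t := norm_smul_inv_norm (c.nz t)
  lipschitz x y hxy := by
    rw [arc_sub]
    exact h x y hxy

lemma hasDerivAt_inner (v : Euc n) (t : ℝ) :
    HasDerivAt (fun t => ⟪c.f t, v⟫) ⟪c.fd t, v⟫ t := by
  simpa using (c.deriv t).inner ℝ (hasDerivAt_const t v)

lemma curvature_bound_pos {κ : ℝ} (hL : 0 < L) (h : TangentLip c.toClosedC1 κ) : 0 < κ := by
  by_contra! hκ
  have hc := c.hasCurvatureLE h
  have hconst : ∀ t, 0 ≤ t → c.tangent t = c.tangent 0 := fun t ht => by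
    have h1 := hc.lipschitz 0 t ht
    have h2 := hc.strictMono_arc.monotone ht
    have h3 := mul_nonpos_of_nonpos_of_nonneg hκ (sub_nonneg.2 h2)
    exact sub_eq_zero.1 (norm_le_zero_iff.1 (h1.trans h3))
  have hd := hc.hasDerivAt_inner (c.tangent 0)
  have hmono : StrictMonoOn (fun t => ⟪c.f t, c.tangent 0⟫) (Icc 0 L) := by
    refine strictMonoOn_of_deriv_pos (convex_Icc 0 L)
      (fun s _ => (hd s).continuousAt.continuousWithinAt) fun s hs => ?_
    rw [(hd s).deriv, hconst s (interior_subset hs).1, real_inner_self_eq_norm_sq,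
      hc.norm_tangent]
    simpa using c.nz s
  have h1 := hmono (left_mem_Icc.2 hL.le) (right_mem_Icc.2 hL.le) hL
  have h2 := c.per 0
  rw [zero_add] at h2
  simp only [h2, lt_irrefl] at h1

lemma exists_mem_tangent_ball (hL : 0 < L) : ∃ r > 0, ∃ s t : ℝ, ∃ w : Euc n,
    ‖w‖ = 1 ∧ ⟪w, c.fd s⟫ = 0 ∧ ‖c.f t - c.f s - r • w‖ < r := by
  set v := c.fd 0 with hv
  have hd := c.hasDerivAt_inner v
  have hper : Function.Periodic (fun t => ⟪c.f t, v⟫) L := fun t => by simp only [c.per]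
  have hcont : Continuous fun t => ⟪c.f t, v⟫ :=
    continuous_iff_continuousAt.2 fun t => (hd t).continuousAt
  obtain ⟨s, -, hs⟩ := isCompact_Icc.exists_isMaxOn (nonempty_Icc.2 hL.le) hcont.continuousOn
  have hmax : ∀ t, ⟪c.f t, v⟫ ≤ ⟪c.f s, v⟫ := fun t => by
    obtain ⟨y, hy, hyt⟩ := hper.exists_mem_Ico₀ hL t
    rw [hyt]
    exact isMaxOn_iff.1 hs y (Ico_subset_Icc_self hy)
  have hv0 : ‖v‖ ≠ 0 := norm_ne_zero_iff.2 (c.nz 0)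
  have hlt : ⟪c.f 0, v⟫ < ⟪c.f s, v⟫ := by
    refine lt_of_le_of_ne (hmax 0) fun heq => ?_
    have hloc : IsLocalMax (fun t => ⟪c.f t, v⟫) 0 := Eventually.of_forall fun t => by
      simpa only [heq] using hmax t
    have h0 := hloc.hasDerivAt_eq_zero (hd 0)
    rw [← hv, real_inner_self_eq_norm_sq] at h0
    exact hv0 (pow_eq_zero_iff two_ne_zero |>.1 h0)
  have hperp : ⟪c.fd s, v⟫ = 0 :=
    IsLocalMax.hasDerivAt_eq_zero (f := fun t => ⟪c.f t, v⟫) (Eventually.of_forall hmax) (hd s)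
  set w : Euc n := -(‖v‖⁻¹ • v) with hw
  have hw1 : ‖w‖ = 1 := by rw [hw, norm_neg]; exact norm_smul_inv_norm (c.nz 0)
  have hin : 0 < ⟪c.f 0 - c.f s, w⟫ := by
    rw [hw, inner_neg_right, real_inner_smul_right, inner_sub_left, ← mul_neg, neg_sub]
    have := sub_pos.2 hlt
    positivity
  obtain ⟨r, hr⟩ := exists_gt (max 0 (‖c.f 0 - c.f s‖ ^ 2 / (2 * ⟪c.f 0 - c.f s, w⟫)))
  rw [max_lt_iff, div_lt_iff₀ (by positivity)] at hr
  refine ⟨r, hr.1, s, 0, w, hw1, ?_, ?_⟩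
  · rw [hw, inner_neg_left, real_inner_smul_left, real_inner_comm, hperp, mul_zero, neg_zero]
  · rw [norm_sub_smul_lt_iff hr.1 hw1]
    linarith [hr.2]

lemma inv_le_RO {κ : ℝ} (hL : 0 < L) (hκ : 0 < κ)
    (hout : ∀ s t : ℝ, ∀ w : Euc n, ‖w‖ = 1 → ⟪w, c.fd s⟫ = 0 →
      2 * ⟪c.f t - c.f s, w⟫ ≤ κ * ‖c.f t - c.f s‖ ^ 2) :
    κ⁻¹ ≤ RO c.f c.fd univ := by
  refine le_csInf ?_ ?_
  · obtain ⟨r, hr, s, t, w, h⟩ := c.exists_mem_tangent_ball hL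
    exact ⟨r, hr, s, mem_univ s, t, mem_univ t, w, h⟩
  · rintro r ⟨hr, s, -, t, -, w, hw, hws, hlt⟩
    rw [norm_sub_smul_lt_iff hr hw] at hlt
    by_contra! hrκ
    have h1 := hout s t w hw hws
    have hrκ' : κ * r < 1 := by
      have := mul_lt_mul_of_pos_left hrκ hκ
      rwa [mul_inv_cancel₀ hκ.ne'] at this
    have hpos : 0 < ⟪c.f t - c.f s, w⟫ := by
      refine pos_of_mul_pos_right (a := 2 * r) ?_ (by positivity)
      exact (sq_nonneg _).trans_lt hlt
    have h2 := mul_lt_mul_of_pos_left hlt hκ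
    nlinarith

end ClosedC11

lemma TendstoUniformly.comp_tendsto_atTop {n : ℕ} {F : ℕ → ℝ → Euc n} {f : ℝ → Euc n}
    (h : TendstoUniformly F f atTop) (hf : Continuous f) {φ : ℕ → ℕ} (hφ : Tendsto φ atTop atTop)
    {x : ℕ → ℝ} {a : ℝ} (hx : Tendsto x atTop (𝓝 a)) :
    Tendsto (fun k => F (φ k) (x k)) atTop (𝓝 (f a)) :=
  TendstoUniformly.tendsto_comp (F := fun k => F (φ k)) (fun u hu => hφ.eventually (h u hu))
    hf.continuousAt hx

/-- Double critical pairs at distance at most `2 / κ` whose connecting arcs are long cannot persist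
along a `C¹`-convergent sequence whose limit has no double critical pair that short. -/
lemma eventually_not_double_critical {n : ℕ} (γ : Knot n) (γm : ℕ → ClosedC11 n γ.L)
    (hconv : TendstoUniformly (fun m => (γm m).f) γ.f atTop)
    (hconvd : TendstoUniformly (fun m => (γm m).fd) γ.fd atTop) {κ : ℝ} (hκ : 0 < κ)
    (hMDC : 2 < κ * MDC γ.f γ.fd) :
    ∀ᶠ m in atTop, ∀ s ∈ Icc (0 : ℝ) γ.L, ∀ t ∈ Icc s (s + γ.L),
      κ * ((γm m).arc t - (γm m).arc s) ∈ Icc Real.pi (κ * (γm m).arc γ.L - Real.pi) →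
        κ * ‖(γm m).f t - (γm m).f s‖ < 2 → ⟪(γm m).f t - (γm m).f s, (γm m).fd s⟫ = 0 →
          ⟪(γm m).f t - (γm m).f s, (γm m).fd t⟫ ≠ 0 := by
  have hspeed : ∀ᶠ m in atTop, ∀ x, ‖(γm m).fd x‖ ≤ 2 := by
    filter_upwards [Metric.tendstoUniformly_iff.1 hconvd 1 one_pos] with m hm x
    have h1 := hm x
    rw [dist_eq_norm, norm_sub_rev] at h1
    have h2 := norm_le_norm_add_norm_sub' ((γm m).fd x) (γ.fd x)
    rw [γ.unit] at h2
    linarith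
  by_contra hcon
  obtain ⟨φ, hφ, H⟩ := extraction_of_frequently_atTop
    ((not_eventually.1 hcon).and_eventually hspeed)
  choose hbad hV using H
  push Not at hbad
  choose s hs t ht harc hlt hcs hct using hbad
  set δ := Real.pi / (2 * κ) with hδ
  have hδ0 : 0 < δ := by positivity
  have harcle : ∀ k x y, x ≤ y → (γm (φ k)).arc y - (γm (φ k)).arc x ≤ 2 * (y - x) := by
    intro k x y hxy
    rw [ClosedC11.arc_sub]
    refine (le_abs_self _).trans ?_
    have := intervalIntegral.norm_integral_le_of_norm_le_const (a := x) (b := y)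
      (f := fun u => ‖(γm (φ k)).fd u‖) (C := 2) fun u _ => by simpa using hV k u
    rwa [Real.norm_eq_abs, abs_of_nonneg (sub_nonneg.2 hxy)] at this
  have hδle : ∀ a, Real.pi ≤ κ * (2 * a) → δ ≤ a := fun a ha => by
    rw [hδ, div_le_iff₀ (by positivity)]; linarith
  have hgap : ∀ k, (s k, t k) ∈ (Icc 0 γ.L ×ˢ Icc 0 (2 * γ.L)) ∩
      {p : ℝ × ℝ | p.1 + δ ≤ p.2 ∧ p.2 + δ ≤ p.1 + γ.L} := by
    intro k
    refine ⟨⟨hs k, ?_, ?_⟩, ?_, ?_⟩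
    · exact (hs k).1.trans (ht k).1
    · linarith [(hs k).2, (ht k).2]
    · have := hδle (t k - s k) ((harc k).1.trans
        (mul_le_mul_of_nonneg_left (harcle k _ _ (ht k).1) hκ.le))
      change s k + δ ≤ t k
      linarith
    · have h1 := mul_le_mul_of_nonneg_left (harcle k _ _ (ht k).2) hκ.le
      rw [ClosedC11.arc_add_period] at h1
      have := hδle (s k + γ.L - t k) (by linarith [(harc k).2])
      change t k + δ ≤ s k + γ.L
      linarith
  have hcomp : IsCompact ((Icc 0 γ.L ×ˢ Icc 0 (2 * γ.L)) ∩
      {p : ℝ × ℝ | p.1 + δ ≤ p.2 ∧ p.2 + δ ≤ p.1 + γ.L}) :=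
    (isCompact_Icc.prod isCompact_Icc).inter_right
      (IsClosed.and (isClosed_le (by fun_prop) (by fun_prop))
        (isClosed_le (by fun_prop) (by fun_prop)))
  obtain ⟨⟨a, b⟩, ⟨-, hab⟩, ψ, hψ, hlim⟩ := hcomp.tendsto_subseq hgap
  have hab1 : a + δ ≤ b := hab.1
  have hab2 : b + δ ≤ a + γ.L := hab.2
  have hsa : Tendsto (fun k => s (ψ k)) atTop (𝓝 a) := (continuous_fst.tendsto _).comp hlim
  have htb : Tendsto (fun k => t (ψ k)) atTop (𝓝 b) := (continuous_snd.tendsto _).comp hlim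
  have hφψ : Tendsto (fun k => φ (ψ k)) atTop atTop := hφ.tendsto_atTop.comp hψ.tendsto_atTop
  have hfs := hconv.comp_tendsto_atTop γ.continuous_f hφψ hsa
  have hft := hconv.comp_tendsto_atTop γ.continuous_f hφψ htb
  have hds := hconvd.comp_tendsto_atTop γ.continuous_fd hφψ hsa
  have hdt := hconvd.comp_tendsto_atTop γ.continuous_fd hφψ htb
  have hX := hft.sub hfs
  have h1 : ⟪γ.f b - γ.f a, γ.fd a⟫ = 0 :=
    tendsto_nhds_unique (hX.inner hds)
      (tendsto_const_nhds.congr fun k => (hcs (ψ k)).symm)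
  have h2 : ⟪γ.f b - γ.f a, γ.fd b⟫ = 0 :=
    tendsto_nhds_unique (hX.inner hdt)
      (tendsto_const_nhds.congr fun k => (hct (ψ k)).symm)
  have h3 : κ * ‖γ.f b - γ.f a‖ ≤ 2 :=
    le_of_tendsto (hX.norm.const_mul κ) (Eventually.of_forall fun k => (hlt (ψ k)).le)
  have h4 := γ.MDC_le (γ.f_ne (by linarith) (by linarith) : γ.f a ≠ γ.f b).symm h2 h1
  have := mul_le_mul_of_nonneg_left h4 hκ.le
  linarith

/-- Let `γ_m → γ` in `C¹`, with unit tangents uniformly `C`-Lipschitz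
w.r.t. arclength, and with all modifications supported in a compact set `A`. If
`F_k(γ) < MDC(K)/2` and each `γ_m` has `F_k(γ_m) ≥ F_k(γ)` (its unit tangent is
`1/F_k(γ)`-Lipschitz w.r.t. arclength), then `R_O(K_m) ≥ R_O(K)` for all sufficiently
large `m`. -/
theorem statement_18 {n : ℕ} (hn : 2 ≤ n) (γ : Knot n)
    (γm : ℕ → ClosedC11 n γ.L)
    (hconv : TendstoUniformly (fun m => (γm m).f) γ.f atTop)
    (hconvd : TendstoUniformly (fun m => (γm m).fd) γ.fd atTop)
    (C : ℝ) (hC : ∀ m, TangentLip (γm m).toClosedC1 C)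
    (A : Set ℝ) (hA : IsCompact A)
    (hAsub : ∀ m, {s : ℝ | s ∈ Set.Icc (0 : ℝ) γ.L ∧ (γm m).f s ≠ γ.f s} ⊆ A)
    (hFk : γ.Fk < MDC γ.f γ.fd / 2)
    (hFkm : ∀ m, TangentLip (γm m).toClosedC1 (γ.Fk)⁻¹) :
    ∃ m₁ : ℕ, ∀ m ≥ m₁, RO γ.f γ.fd Set.univ ≤ RO (γm m).f (γm m).fd Set.univ := by
  have hκ : 0 < γ.Fk⁻¹ := (γm 0).curvature_bound_pos γ.Lpos (hFkm 0)
  have hF : 0 < γ.Fk := inv_pos.1 hκ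
  have hMDC : 2 < γ.Fk⁻¹ * MDC γ.f γ.fd := by
    rw [inv_mul_eq_div, lt_div_iff₀ hF]
    linarith
  obtain ⟨m₁, hm₁⟩ :=
    eventually_atTop.1 (eventually_not_double_critical γ γm hconv hconvd hκ hMDC)
  refine ⟨m₁, fun m hm => (γ.RO_le_Fk (inv_pos.1 hF)).trans ?_⟩
  have hle := (γm m).inv_le_RO γ.Lpos hκ fun s t w hw hws =>
    ((γm m).hasCurvatureLE (hFkm m)).two_mul_inner_le_of_closed hκ γ.Lpos (γm m).per
      (γm m).tangent_add_period (γm m).arc_add_period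
      (fun s hs t ht h1 h2 h3 h4 => hm₁ m hm s hs t ht h1 h2
        ((γm m).inner_tangent_eq_zero.1 h3) ((γm m).inner_tangent_eq_zero.1 h4))
      hw ((γm m).inner_tangent_eq_zero.2 hws)
  rwa [inv_inv] at hle
end

section
/- Let γ be a relatively extremal knot in ℝⁿ (n ≥ 2) with image K. (i) If MDC(K) = 2·R_O(K), then every x ∈ ℝ/Lℤ with κγ(x) < 1/R_O(K) and x ∉ I_c has an open neighborhood in ℝ/Lℤ on which γ' is constant (so K minus the union of the minimal double critical points and the points of maximal curvature is a countable union of open line segments); in particular I_b ⊆ I_c. (ii) If MDC(K) > 2·R_O(K), then every x ∈ ℝ/Lℤ with κγ(x) < 1/R_O(K) has an open neighborhood in ℝ/Lℤ on which γ' is constant (so K minus the points of maximal curvature is a countable union of open line segments). -/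
open Set Filter MeasureTheory
open scoped RealInnerProductSpace Topology ENNReal

section InnerProduct

variable {E : Type*} [NormedAddCommGroup E] [InnerProductSpace ℝ E]

/-- The curve `f` with tangent field `G` never enters the open balls of radius `R` tangent to it. -/
def Thick (R : ℝ) (f G : ℝ → E) : Prop :=
  ∀ s t : ℝ, ∀ w : E, ‖w‖ = 1 → ⟪w, G s⟫ = 0 → 2 * R * ⟪f t - f s, w⟫ ≤ ‖f t - f s‖ ^ 2

/-- A polynomial in the chord `v` and the tangent `u` whose sign detects whether the endpoint of
the chord lies in an open ball of radius `R` tangent to `u`. -/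
def tangentGap (R : ℝ) (v u : E) : ℝ :=
  ‖v‖ ^ 4 * ‖u‖ ^ 2 - 4 * R ^ 2 * (‖v‖ ^ 2 * ‖u‖ ^ 2 - ⟪v, u⟫ ^ 2)

lemma le_of_tangentGap_nonneg {R : ℝ} {v u w : E} (hu : u ≠ 0)
    (hg : 0 ≤ tangentGap R v u) (hw : ‖w‖ = 1) (hwu : ⟪w, u⟫ = 0) :
    2 * R * ⟪v, w⟫ ≤ ‖v‖ ^ 2 := by
  have hu0 : 0 < ‖u‖ ^ 2 := by positivity
  have hz : ⟪‖u‖ ^ 2 • v - ⟪v, u⟫ • u, w⟫ = ‖u‖ ^ 2 * ⟪v, w⟫ := by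
    rw [inner_sub_left, real_inner_smul_left, real_inner_smul_left, real_inner_comm w u, hwu]
    ring
  have hzn : ‖‖u‖ ^ 2 • v - ⟪v, u⟫ • u‖ ^ 2 =
      ‖u‖ ^ 2 * (‖v‖ ^ 2 * ‖u‖ ^ 2 - ⟪v, u⟫ ^ 2) := by
    rw [@norm_sub_sq_real, norm_smul, norm_smul, real_inner_smul_left, real_inner_smul_right,
      mul_pow, mul_pow, Real.norm_eq_abs, Real.norm_eq_abs, sq_abs, sq_abs]
    ring
  have hcs := abs_real_inner_le_norm (‖u‖ ^ 2 • v - ⟪v, u⟫ • u) w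
  rw [hw, mul_one, hz] at hcs
  have h2 := pow_le_pow_left₀ (abs_nonneg _) hcs 2
  rw [sq_abs, hzn] at h2
  have h3 : ‖u‖ ^ 2 * ⟪v, w⟫ ^ 2 ≤ ‖v‖ ^ 2 * ‖u‖ ^ 2 - ⟪v, u⟫ ^ 2 := by
    refine le_of_mul_le_mul_left ?_ hu0
    linarith
  have h4 : ‖u‖ ^ 2 * (2 * R * ⟪v, w⟫) ^ 2 ≤ ‖u‖ ^ 2 * (‖v‖ ^ 2) ^ 2 := by
    unfold tangentGap at hg
    nlinarith [mul_le_mul_of_nonneg_left h3 (by positivity : 0 ≤ 4 * R ^ 2)]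
  exact le_of_abs_le (abs_le_of_sq_le_sq (le_of_mul_le_mul_left h4 hu0) (by positivity))

lemma exists_touching_of_tangentGap_nonpos {R : ℝ} {v u : E} (hR : 0 ≤ R) (hv : v ≠ 0)
    (hu : ‖u‖ = 1) (hg : tangentGap R v u ≤ 0) :
    ∃ w : E, ‖w‖ = 1 ∧ ⟪w, u⟫ = 0 ∧ ‖v‖ ^ 2 ≤ 2 * R * ⟪v, w⟫ := by
  set p : E := v - ⟪v, u⟫ • u with hp
  have hpu : ⟪p, u⟫ = 0 := by
    rw [hp, inner_sub_left, real_inner_smul_left, real_inner_self_eq_norm_sq, hu]; ring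
  have hpn : ‖p‖ ^ 2 = ‖v‖ ^ 2 - ⟪v, u⟫ ^ 2 := by
    rw [hp, @norm_sub_sq_real, norm_smul, real_inner_smul_right, mul_pow, hu, Real.norm_eq_abs,
      sq_abs]
    ring
  have hvp : ⟪v, p⟫ = ‖p‖ ^ 2 := by
    rw [hpn, hp, inner_sub_right, real_inner_smul_right, real_inner_self_eq_norm_sq]; ring
  have h4 : (‖v‖ ^ 2) ^ 2 ≤ (2 * R * ‖p‖) ^ 2 := by
    unfold tangentGap at hg
    rw [hu] at hg
    rw [mul_pow, hpn]
    linarith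
  have h5 : ‖v‖ ^ 2 ≤ 2 * R * ‖p‖ :=
    le_of_abs_le (abs_le_of_sq_le_sq h4 (by positivity))
  have hp0 : ‖p‖ ≠ 0 := by
    intro h0
    have : 0 < ‖v‖ ^ 2 := by positivity
    rw [h0] at h5
    linarith
  refine ⟨‖p‖⁻¹ • p, ?_, ?_, ?_⟩
  · rw [norm_smul, norm_inv, norm_norm, inv_mul_cancel₀ hp0]
  · rw [real_inner_smul_left, hpu, mul_zero]
  · rw [real_inner_smul_right, hvp, sq ‖p‖, inv_mul_cancel_left₀ hp0]
    exact h5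

lemma inner_eq_zero_of_touching {R : ℝ} {f T : ℝ → E} (hf : ∀ s, HasDerivAt f (T s) s)
    (hthick : Thick R f T) {s t : ℝ} {w : E} (hw : ‖w‖ = 1) (hws : ⟪w, T s⟫ = 0)
    (h : ‖f t - f s‖ ^ 2 ≤ 2 * R * ⟪f t - f s, w⟫) : ⟪f t - f s - R • w, T t⟫ = 0 := by
  have hmin : IsLocalMin (fun y => ‖f y - f s‖ ^ 2 - 2 * R * ⟪f y - f s, w⟫) t :=
    Eventually.of_forall fun y => by
      have := hthick s y w hw hws
      simp only
      linarith
  have hd : HasDerivAt (fun y => f y - f s) (T t) t := (hf t).sub_const _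
  have hd1 := hd.norm_sq
  have hd2 := hd.inner ℝ (hasDerivAt_const t w)
  have := hmin.hasDerivAt_eq_zero (hd1.sub (hd2.const_mul (2 * R)))
  rw [inner_zero_right, real_inner_comm] at this
  rw [inner_sub_left, real_inner_smul_left, real_inner_comm, real_inner_comm (T t) w]
  linarith

lemma inner_chord_eq_zero_of_touching {R Λ : ℝ} {f T : ℝ → E}
    (hf : ∀ s, HasDerivAt f (T s) s) (hT : Continuous T) (hunit : ∀ s, ‖T s‖ = 1)
    (hthick : Thick R f T) (hR : 0 < R) (hRΛ : R * Λ < 1) {x t : ℝ}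
    (hΛ : ∀ᶠ s in 𝓝 x, ‖T s - T x‖ ≤ Λ * |s - x|) {w : E} (hw : ‖w‖ = 1)
    (hwx : ⟪w, T x⟫ = 0) (h : ‖f t - f x‖ ^ 2 = 2 * R * ⟪f t - f x, w⟫) :
    ⟪f t - f x, T x⟫ = 0 := by
  set p := ⟪f t - f x, T x⟫ with hp
  obtain ⟨σ, hσ, hσp⟩ : ∃ σ : ℝ, |σ| = 1 ∧ σ * p = |p| := by
    rcases le_total 0 p with h0 | h0
    · exact ⟨1, by simp, by rw [abs_of_nonneg h0, one_mul]⟩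
    · exact ⟨-1, by simp, by rw [abs_of_nonpos h0]; ring⟩
  set A : ℝ → ℝ := fun h => ‖f t - f (x + σ * h)‖ ^ 2 - 2 * R * ⟪f t - f (x + σ * h), w⟫ with hA
  have hA0 : A 0 = 0 := by simp [hA, h]
  have hlin : HasDerivAt (fun h : ℝ => x + σ * h) σ 0 := by
    simpa using ((hasDerivAt_id (0 : ℝ)).const_mul σ).const_add x
  have hcont : Tendsto (fun h : ℝ => x + σ * h) (𝓝[>] 0) (𝓝 x) := by
    have := hlin.continuousAt.tendsto
    simp only [mul_zero, add_zero] at this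
    exact this.mono_left nhdsWithin_le_nhds
  have hdA : HasDerivAt A (-2 * |p|) 0 := by
    have h1 : HasDerivAt (fun h => f t - f (x + σ * h)) (-(σ • T x)) 0 := by
      refine HasDerivAt.const_sub (f t) (HasDerivAt.scomp (0 : ℝ) ?_ hlin)
      simpa using hf x
    refine (h1.norm_sq.sub ((h1.inner ℝ (hasDerivAt_const 0 w)).const_mul (2 * R))).congr_deriv ?_
    rw [inner_zero_right, inner_neg_right, inner_neg_left, real_inner_smul_right,
      real_inner_smul_left, real_inner_comm w (T x), hwx, ← hσp, hp]
    simp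
  have hlim1 : Tendsto (fun h => h⁻¹ * A h) (𝓝[>] 0) (𝓝 (-2 * |p|)) := by
    have := hdA.tendsto_slope_zero_right
    simpa [hA0] using this
  have hfc : Continuous f := continuous_iff_continuousAt.2 fun s => (hf s).continuousAt
  have hlim2 : Tendsto (fun h => -2 * R * Λ * |⟪f t - f (x + σ * h), T (x + σ * h)⟫|) (𝓝[>] 0)
      (𝓝 (-2 * R * Λ * |p|)) := by
    have hc : Continuous fun y => -2 * R * Λ * |⟪f t - f y, T y⟫| := by fun_prop
    exact (hc.tendsto x).comp hcont
  have hle : ∀ᶠ h in 𝓝[>] (0 : ℝ),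
      -2 * R * Λ * |⟪f t - f (x + σ * h), T (x + σ * h)⟫| ≤ h⁻¹ * A h := by
    filter_upwards [hcont.eventually hΛ, self_mem_nhdsWithin] with h hh hpos
    have hpos : 0 < h := hpos
    set s := x + σ * h with hs
    have hsx : |s - x| = h := by rw [hs, add_sub_cancel_left, abs_mul, hσ, abs_of_pos hpos, one_mul]
    rw [hsx] at hh
    set v := f t - f s
    set u := w - ⟪w, T s⟫ • T s with hu
    have hwTs : |⟪w, T s⟫| ≤ Λ * h := by
      have : ⟪w, T s⟫ = ⟪w, T s - T x⟫ := by rw [inner_sub_right, hwx, sub_zero]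
      rw [this]
      refine (abs_real_inner_le_norm _ _).trans ?_
      rwa [hw, one_mul]
    have hus : ⟪u, T s⟫ = 0 := by
      rw [hu, inner_sub_left, real_inner_smul_left, real_inner_self_eq_norm_sq, hunit]; ring
    have hun : ‖u‖ ≤ 1 := by
      have : ‖u‖ ^ 2 = 1 - ⟪w, T s⟫ ^ 2 := by
        rw [hu, @norm_sub_sq_real, norm_smul, real_inner_smul_right, mul_pow, hunit,
          Real.norm_eq_abs, sq_abs, hw]
        ring
      nlinarith [sq_nonneg ⟪w, T s⟫, norm_nonneg u]
    have hvu : 2 * R * ⟪v, u⟫ ≤ ‖v‖ ^ 2 := by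
      rcases eq_or_ne u 0 with h0 | h0
      · rw [h0, inner_zero_right, mul_zero]; positivity
      · have hu0 : ‖u‖ ≠ 0 := norm_ne_zero_iff.2 h0
        have := hthick s t (‖u‖⁻¹ • u)
          (by rw [norm_smul, norm_inv, norm_norm, inv_mul_cancel₀ hu0])
          (by rw [real_inner_smul_left, hus, mul_zero])
        rw [real_inner_smul_right] at this
        have h3 := mul_le_mul_of_nonneg_left this (norm_nonneg u)
        have h4 : ‖u‖ * (2 * R * (‖u‖⁻¹ * ⟪f t - f s, u⟫)) = 2 * R * ⟪v, u⟫ := by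
          field_simp
          rfl
        rw [h4] at h3
        exact h3.trans (mul_le_of_le_one_left (by positivity) hun)
    have hAv : A h = ‖v‖ ^ 2 - 2 * R * ⟪v, w⟫ := rfl
    have hvw : ⟪v, u⟫ = ⟪v, w⟫ - ⟪w, T s⟫ * ⟪v, T s⟫ := by
      rw [hu, inner_sub_right, real_inner_smul_right]
    have hprod : ⟪w, T s⟫ * ⟪v, T s⟫ ≤ Λ * h * |⟪v, T s⟫| := by
      refine (le_abs_self _).trans ?_
      rw [abs_mul]
      gcongr
    have hAh : -2 * R * Λ * |⟪v, T s⟫| * h ≤ A h := by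
      rw [hAv]
      rw [hvw] at hvu
      nlinarith [mul_le_mul_of_nonneg_left hprod hR.le]
    rw [inv_mul_eq_div, le_div_iff₀ hpos]
    exact hAh
  have hfin := le_of_tendsto_of_tendsto hlim2 hlim1 hle
  have : |p| ≤ 0 := by nlinarith [abs_nonneg p]
  exact abs_nonpos_iff.1 this

lemma false_of_touching {R Λ : ℝ} {f T : ℝ → E}
    (hf : ∀ s, HasDerivAt f (T s) s) (hT : Continuous T) (hunit : ∀ s, ‖T s‖ = 1)
    (hthick : Thick R f T) (hR : 0 < R) (hRΛ : R * Λ < 1) {x t : ℝ}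
    (hΛ : ∀ᶠ s in 𝓝 x, ‖T s - T x‖ ≤ Λ * |s - x|)
    (hno : ∀ y, f x ≠ f y → ⟪f x - f y, T x⟫ = 0 → ⟪f x - f y, T y⟫ = 0 → ‖f x - f y‖ ≠ 2 * R)
    (hne : f t ≠ f x) {w : E} (hw : ‖w‖ = 1) (hwx : ⟪w, T x⟫ = 0)
    (h : ‖f t - f x‖ ^ 2 ≤ 2 * R * ⟪f t - f x, w⟫) : False := by
  have heq : ‖f t - f x‖ ^ 2 = 2 * R * ⟪f t - f x, w⟫ := le_antisymm h (hthick x t w hw hwx)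
  have hvx := inner_chord_eq_zero_of_touching hf hT hunit hthick hR hRΛ hΛ hw hwx heq
  have hvt := inner_eq_zero_of_touching hf hthick hw hwx h
  set v := f t - f x with hv
  have hv0 : 0 < ‖v‖ := norm_pos_iff.2 (sub_ne_zero.2 hne)
  have hle : ‖v‖ ≤ 2 * R := by
    have h1 := real_inner_le_norm v w
    rw [hw, mul_one] at h1
    nlinarith
  have hge : 2 * R ≤ ‖v‖ := by
    have := hthick x t (‖v‖⁻¹ • v)
      (by rw [norm_smul, norm_inv, norm_norm, inv_mul_cancel₀ hv0.ne'])
      (by rw [real_inner_smul_left, hvx, mul_zero])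
    rw [← hv, real_inner_smul_right, real_inner_self_eq_norm_sq, sq,
      inv_mul_cancel_left₀ hv0.ne'] at this
    exact le_of_mul_le_mul_right this hv0
  have hvn : ‖v‖ = 2 * R := le_antisymm hle hge
  have hvw : ⟪v, w⟫ = 2 * R := by
    rw [hvn] at heq
    have : 2 * R * ⟪v, w⟫ = 2 * R * (2 * R) := by rw [← heq]; ring
    exact mul_left_cancel₀ (by positivity) this
  have hz : v - (2 * R) • w = 0 := by
    have : ‖v - (2 * R) • w‖ ^ 2 = 0 := by
      rw [@norm_sub_sq_real, norm_smul, real_inner_smul_right, hvw, hvn, hw, Real.norm_eq_abs,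
        mul_one, sq_abs]
      ring
    exact norm_eq_zero.1 (pow_eq_zero_iff two_ne_zero |>.1 this)
  have hvt' : ⟪v, T t⟫ = 0 := by
    have : v - R • w = (1 / 2 : ℝ) • v := by
      rw [sub_eq_zero.1 hz, smul_smul, ← sub_smul]
      congr 1
      ring
    rw [this, real_inner_smul_left] at hvt
    linarith
  have hsymm : f x - f t = -v := by rw [hv, neg_sub]
  exact hno t hne.symm (by rw [hsymm, inner_neg_left, hvx, neg_zero])
    (by rw [hsymm, inner_neg_left, hvt', neg_zero]) (by rw [hsymm, norm_neg, hvn])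

lemma tangentGap_pos_of_no_critical {R Λ : ℝ} {f T : ℝ → E}
    (hf : ∀ s, HasDerivAt f (T s) s) (hT : Continuous T) (hunit : ∀ s, ‖T s‖ = 1)
    (hthick : Thick R f T) (hR : 0 < R) (hRΛ : R * Λ < 1) {x t : ℝ}
    (hΛ : ∀ᶠ s in 𝓝 x, ‖T s - T x‖ ≤ Λ * |s - x|)
    (hno : ∀ y, f x ≠ f y → ⟪f x - f y, T x⟫ = 0 → ⟪f x - f y, T y⟫ = 0 → ‖f x - f y‖ ≠ 2 * R)
    (hne : f t ≠ f x) :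
    0 < tangentGap R (f t - f x) (T x) ∧ 0 < tangentGap R (f x - f t) (T t) := by
  constructor
  · by_contra! hg
    obtain ⟨w, hw, hwx, h⟩ :=
      exists_touching_of_tangentGap_nonpos hR.le (sub_ne_zero.2 hne) (hunit x) hg
    exact false_of_touching hf hT hunit hthick hR hRΛ hΛ hno hne hw hwx h
  · by_contra! hg
    obtain ⟨w, hw, hwt, h⟩ :=
      exists_touching_of_tangentGap_nonpos hR.le (sub_ne_zero.2 hne.symm) (hunit t) hg
    have heq : ‖f x - f t‖ ^ 2 = 2 * R * ⟪f x - f t, w⟫ := le_antisymm h (hthick t x w hw hwt)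
    have hx := inner_eq_zero_of_touching hf hthick hw hwt h
    set z := f x - f t - R • w with hzdef
    have hzn : ‖z‖ ^ 2 = R ^ 2 := by
      rw [hzdef, @norm_sub_sq_real, norm_smul, real_inner_smul_right, hw, heq, Real.norm_eq_abs,
        mul_one, sq_abs]
      ring
    have hzR : ‖z‖ = R := by
      rwa [sq_eq_sq₀ (norm_nonneg _) hR.le] at hzn
    refine false_of_touching hf hT hunit hthick hR hRΛ hΛ hno hne (w := -(R⁻¹ • z)) ?_ ?_ ?_
    · rw [norm_neg, norm_smul, norm_inv, Real.norm_eq_abs, abs_of_pos hR, hzR,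
        inv_mul_cancel₀ hR.ne']
    · rw [inner_neg_left, real_inner_smul_left, hx, mul_zero, neg_zero]
    · have hsymm : f t - f x = -(f x - f t) := by rw [neg_sub]
      rw [hsymm, inner_neg_neg, norm_neg, real_inner_smul_right, hzdef, inner_sub_right,
        real_inner_smul_right, real_inner_self_eq_norm_sq]
      have : 2 * R * (R⁻¹ * (‖f x - f t‖ ^ 2 - R * ⟪f x - f t, w⟫)) =
          2 * ‖f x - f t‖ ^ 2 - 2 * R * ⟪f x - f t, w⟫ := by
        field_simp
      rw [this, ← heq]
      linarith

end InnerProduct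

section Thickness

variable {n : ℕ}

lemma RO_nonneg (f G : ℝ → Euc n) (D : Set ℝ) : 0 ≤ RO f G D :=
  Real.sInf_nonneg fun _ hr => hr.1.le

lemma thick_RO (f G : ℝ → Euc n) : Thick (RO f G univ) f G := by
  intro s t w hw hws
  by_contra! hlt
  have hpos : 0 < ⟪f t - f s, w⟫ := by
    have h0 := RO_nonneg f G univ
    by_contra! hle
    nlinarith [sq_nonneg ‖f t - f s‖]
  obtain ⟨r, hr1, hr2⟩ :
      ∃ r, ‖f t - f s‖ ^ 2 / (2 * ⟪f t - f s, w⟫) < r ∧ r < RO f G univ := by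
    refine exists_between ?_
    rw [div_lt_iff₀ (by positivity)]
    linarith
  have hr0 : 0 < r := lt_of_le_of_lt (by positivity) hr1
  rw [div_lt_iff₀ (by positivity)] at hr1
  refine absurd hr2 (not_lt.2 (csInf_le ⟨0, fun _ h => h.1.le⟩
    ⟨hr0, s, mem_univ _, t, mem_univ _, w, hw, hws, ?_⟩))
  refine lt_of_pow_lt_pow_left₀ 2 hr0.le ?_
  rw [@norm_sub_sq_real, norm_smul, real_inner_smul_right, hw, Real.norm_eq_abs, mul_one, sq_abs]
  linarith

lemma Knot.exists_ball_meets (k : Knot n) : ∃ r : ℝ, 0 < r ∧ ∃ s ∈ (univ : Set ℝ),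
    ∃ t ∈ (univ : Set ℝ), ∃ w : Euc n,
      ‖w‖ = 1 ∧ ⟪w, k.fd s⟫ = 0 ∧ ‖k.f t - k.f s - r • w‖ < r := by
  have hd : ∀ t, HasDerivAt (fun t => ⟪k.fd 0, k.f t⟫) ⟪k.fd 0, k.fd t⟫ t := fun t => by
    simpa using (hasDerivAt_const t (k.fd 0)).inner ℝ (k.deriv t)
  obtain ⟨c, -, hc⟩ := exists_hasDerivAt_eq_zero k.Lpos
    (fun t _ => (hd t).continuousAt.continuousWithinAt)
    (by simpa using (congrArg (fun z => ⟪k.fd 0, z⟫) (k.per 0)).symm) (fun t _ => hd t)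
  set p : ℝ → Euc n := fun t => k.f t - k.f 0 - ⟪k.fd 0, k.f t - k.f 0⟫ • k.fd 0 with hp
  obtain ⟨t, ht⟩ : ∃ t, p t ≠ 0 := by
    by_contra! h0
    have h1 : HasDerivAt p (k.fd c - ⟪k.fd 0, k.fd c⟫ • k.fd 0) c := by
      have h2 : HasDerivAt (fun t => k.f t - k.f 0) (k.fd c) c := (k.deriv c).sub_const _
      have h3 : HasDerivAt (fun t => ⟪k.fd 0, k.f t - k.f 0⟫) ⟪k.fd 0, k.fd c⟫ c := by
        simpa using (hasDerivAt_const c (k.fd 0)).inner ℝ h2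
      exact h2.sub (h3.smul_const _)
    have h2 : p = fun _ => 0 := funext h0
    rw [h2] at h1
    have h3 := h1.unique (hasDerivAt_const c 0)
    rw [hc, zero_smul, sub_zero] at h3
    have := k.unit c
    rw [h3, norm_zero] at this
    exact zero_ne_one this
  have ht0 : 0 < ‖p t‖ := norm_pos_iff.2 ht
  have hort : ⟪p t, k.fd 0⟫ = 0 := by
    simp only [hp]
    rw [inner_sub_left, real_inner_smul_left, real_inner_self_eq_norm_sq, k.unit,
      real_inner_comm]
    ring
  have hin : ⟪k.f t - k.f 0, p t⟫ = ‖p t‖ ^ 2 := by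
    have h1 : k.f t - k.f 0 = p t + ⟪k.fd 0, k.f t - k.f 0⟫ • k.fd 0 := by simp [hp]
    conv_lhs => rw [h1]
    rw [inner_add_left, real_inner_smul_left, real_inner_comm, real_inner_comm (p t) (k.fd 0),
      hort, real_inner_self_eq_norm_sq]
    ring
  have hv : k.f t - k.f 0 ≠ 0 := by
    intro h0
    rw [h0, inner_zero_left] at hin
    exact (by positivity : ‖p t‖ ^ 2 ≠ 0) hin.symm
  have hv0 : 0 < ‖k.f t - k.f 0‖ := norm_pos_iff.2 hv
  refine ⟨‖k.f t - k.f 0‖ ^ 2 / ‖p t‖, by positivity, 0, mem_univ _, t, mem_univ _,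
    ‖p t‖⁻¹ • p t, ?_, ?_, ?_⟩
  · rw [norm_smul, norm_inv, norm_norm, inv_mul_cancel₀ ht0.ne']
  · rw [real_inner_smul_left, hort, mul_zero]
  · refine lt_of_pow_lt_pow_left₀ 2 (by positivity) ?_
    rw [@norm_sub_sq_real, norm_smul, norm_smul, real_inner_smul_right, real_inner_smul_right, hin,
      norm_inv, norm_norm, inv_mul_cancel₀ ht0.ne', Real.norm_eq_abs, mul_one, sq_abs]
    have : ‖k.f t - k.f 0‖ ^ 2 / ‖p t‖ * (‖p t‖⁻¹ * ‖p t‖ ^ 2) = ‖k.f t - k.f 0‖ ^ 2 := by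
      field_simp
    rw [this]
    have : 0 < ‖k.f t - k.f 0‖ ^ 2 := by positivity
    linarith

lemma Knot.le_RO_of_thick (k : Knot n) {R : ℝ} (h : Thick R k.f k.fd) :
    R ≤ RO k.f k.fd univ := by
  refine le_csInf k.exists_ball_meets ?_
  rintro r ⟨hr, s, -, t, -, w, hw, hws, hlt⟩
  have h1 := h s t w hw hws
  have h2 := pow_lt_pow_left₀ hlt (norm_nonneg _) two_ne_zero
  rw [@norm_sub_sq_real, norm_smul, real_inner_smul_right, hw, Real.norm_eq_abs, mul_one,
    sq_abs] at h2
  by_contra! hlt'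
  have hpos : 0 < ⟪k.f t - k.f s, w⟫ := by
    by_contra! hle
    nlinarith [sq_nonneg ‖k.f t - k.f s‖]
  nlinarith

lemma norm_sub_le_angle {u v : Euc n} (hu : ‖u‖ = 1) (hv : ‖v‖ = 1) :
    ‖u - v‖ ≤ InnerProductGeometry.angle u v := by
  refine le_of_abs_le (abs_le_of_sq_le_sq ?_ (InnerProductGeometry.angle_nonneg _ _))
  rw [@norm_sub_sq_real, ← InnerProductGeometry.cos_angle_mul_norm_mul_norm, hu, hv]
  have := Real.one_sub_sq_div_two_le_cos (x := InnerProductGeometry.angle u v)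
  linarith

lemma angle_le_norm_sub {u v : Euc n} (hu : ‖u‖ = 1) (hv : ‖v‖ = 1) :
    InnerProductGeometry.angle u v ≤ Real.pi / 2 * ‖u - v‖ := by
  set θ := InnerProductGeometry.angle u v with hθ
  have h0 : 0 ≤ θ := InnerProductGeometry.angle_nonneg _ _
  have h1 : θ ≤ Real.pi := InnerProductGeometry.angle_le_pi _ _
  have hpi := Real.pi_pos
  have hcos : Real.cos θ = 1 - 2 * Real.sin (θ / 2) ^ 2 := by
    have := Real.cos_two_mul (θ / 2)
    rw [mul_div_cancel₀ _ two_ne_zero] at this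
    rw [this, Real.cos_sq']
    ring
  have hsin : 2 / Real.pi * (θ / 2) ≤ Real.sin (θ / 2) :=
    Real.mul_le_sin (by linarith) (by linarith)
  have hnorm : (2 * (2 / Real.pi * (θ / 2))) ^ 2 ≤ ‖u - v‖ ^ 2 := by
    rw [@norm_sub_sq_real, ← InnerProductGeometry.cos_angle_mul_norm_mul_norm, hu, hv, ← hθ, hcos]
    have := pow_le_pow_left₀ (by positivity) hsin 2
    linarith
  have h2 := le_of_abs_le (abs_le_of_sq_le_sq hnorm (norm_nonneg _))
  have h3 := mul_le_mul_of_nonneg_left h2 (by positivity : 0 ≤ Real.pi / 2)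
  calc θ = Real.pi / 2 * (2 * (2 / Real.pi * (θ / 2))) := by field_simp
    _ ≤ _ := h3

lemma Knot.exists_local_lipschitz (k : Knot n) {x Λ : ℝ} (h : curvAt k.fd univ x < Λ) :
    ∃ Λ', 0 ≤ Λ' ∧ Λ' < Λ ∧ ∃ δ > 0, ∀ s t, |s - x| < δ → |t - x| < δ →
      ‖k.fd s - k.fd t‖ ≤ Λ' * |s - t| := by
  have hne : {Λ : ℝ | 0 ≤ Λ ∧ ∃ δ > 0, ∀ s ∈ (univ : Set ℝ), ∀ t ∈ (univ : Set ℝ), s ≠ t →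
      |s - x| < δ → |t - x| < δ →
      InnerProductGeometry.angle (k.fd s) (k.fd t) ≤ Λ * |s - t|}.Nonempty := by
    obtain ⟨C, hC⟩ := k.lipd
    refine ⟨Real.pi / 2 * C, by positivity, 1, one_pos, fun s _ t _ _ _ _ => ?_⟩
    refine (angle_le_norm_sub (k.unit s) (k.unit t)).trans ?_
    rw [mul_assoc]
    gcongr
    have := hC.dist_le_mul s t
    rwa [dist_eq_norm, Real.dist_eq] at this
  obtain ⟨Λ', ⟨h0, δ, hδ, hb⟩, hlt⟩ := exists_lt_of_csInf_lt hne h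
  refine ⟨Λ', h0, hlt, δ, hδ, fun s t hs ht => ?_⟩
  rcases eq_or_ne s t with rfl | hst
  · simp
  · exact (norm_sub_le_angle (k.unit s) (k.unit t)).trans
      (hb s (mem_univ _) t (mem_univ _) hst hs ht)

lemma Knot.curvAt_le_zero_of_locally_constant (k : Knot n) {x ε : ℝ} (hε : 0 < ε)
    (h : ∀ y z : ℝ, |y - x| < ε → |z - x| < ε → k.fd y = k.fd z) : curvAt k.fd univ x ≤ 0 := by
  refine csInf_le ⟨0, fun _ h => h.1⟩ ⟨le_rfl, ε, hε, fun s _ t _ _ hs ht => ?_⟩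
  rw [h s t hs ht, InnerProductGeometry.angle_self, zero_mul]
  rw [← norm_ne_zero_iff, k.unit]
  exact one_ne_zero

end Thickness

section Reparametrization

lemma injOn_Ico_of_periodic {α : Type*} {g : ℝ → α} {L a : ℝ} (hL : 0 < L)
    (hg : Function.Periodic g L) (h : InjOn g (Ico a (a + L))) (b : ℝ) :
    InjOn g (Ico b (b + L)) := by
  intro s hs t ht hst
  have hmod : ∀ s, g (toIcoMod hL a s) = g s := fun s => by
    rw [toIcoMod]; exact hg.sub_zsmul_eq _
  have h1 : toIcoMod hL a s = toIcoMod hL a t :=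
    h (toIcoMod_mem_Ico hL a s) (toIcoMod_mem_Ico hL a t) (by rw [hmod, hmod, hst])
  rw [← (toIcoMod_eq_self hL).2 hs, ← (toIcoMod_eq_self hL).2 ht]
  rw [toIcoMod_inj] at h1 ⊢
  exact h1

lemma norm_unitize_sub_le {E : Type*} [NormedAddCommGroup E] [InnerProductSpace ℝ E] {u v : E}
    {c : ℝ} (hc : 0 < c) (hu : c ≤ ‖u‖) (hv : c ≤ ‖v‖) :
    ‖‖u‖⁻¹ • u - ‖v‖⁻¹ • v‖ ≤ 2 / c * ‖u - v‖ := by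
  have hu0 : 0 < ‖u‖ := hc.trans_le hu
  have hv0 : 0 < ‖v‖ := hc.trans_le hv
  have h1 : ‖u‖⁻¹ • u - ‖v‖⁻¹ • v = ‖u‖⁻¹ • ((u - v) + ((‖v‖ - ‖u‖) * ‖v‖⁻¹) • v) := by
    rw [smul_add, smul_sub, smul_smul, sub_add, ← sub_smul]
    congr 2
    field_simp
    ring
  have h2 : ‖((‖v‖ - ‖u‖) * ‖v‖⁻¹) • v‖ ≤ ‖u - v‖ := by
    rw [norm_smul, norm_mul, norm_inv, norm_norm, inv_mul_cancel_right₀ hv0.ne', norm_sub_rev u]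
    exact abs_norm_sub_norm_le v u
  rw [h1, norm_smul, norm_inv, norm_norm]
  calc ‖u‖⁻¹ * ‖(u - v) + ((‖v‖ - ‖u‖) * ‖v‖⁻¹) • v‖ ≤ c⁻¹ * (‖u - v‖ + ‖u - v‖) := by
        gcongr
        exact (norm_add_le _ _).trans (by gcongr)
    _ = 2 / c * ‖u - v‖ := by ring

lemma exists_knot_reparametrization {n : ℕ} {L c : ℝ} (hL : 0 < L) {g G : ℝ → Euc n}
    (hg : ∀ s, HasDerivAt g (G s) s) (hgp : Function.Periodic g L) (hGp : Function.Periodic G L)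
    (hinj : InjOn g (Ico 0 L)) (hlip : ∃ C, LipschitzWith C G) (hc : 0 < c)
    (hGc : ∀ s, c ≤ ‖G s‖) (hG1 : ∀ s, ‖G s‖ ≤ 1) :
    ∃ (η : Knot n) (τ : ℝ → ℝ), η.L = ∫ s in (0 : ℝ)..L, ‖G s‖ ∧ (∀ y, η.f y = g (τ y)) ∧
      (∀ y, η.fd y = ‖G (τ y)‖⁻¹ • G (τ y)) ∧ Continuous τ ∧ StrictMono τ ∧
      (∀ y, τ (y + η.L) = τ y + L) ∧ ∀ u, |τ (η.L * u) - L * u| ≤ (1 - c) / c * L := by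
  obtain ⟨C, hC⟩ := hlip
  have hGcont : Continuous fun s => ‖G s‖ := hC.continuous.norm
  have hG0 : ∀ s, 0 < ‖G s‖ := fun s => hc.trans_le (hGc s)
  have hnp : Function.Periodic (fun s => ‖G s‖) L := fun s => by simp only [hGp s]
  set σ : ℝ → ℝ := fun s => ∫ y in (0 : ℝ)..s, ‖G y‖ with hσ
  have hσ0 : σ 0 = 0 := by simp [hσ]
  have hσd : ∀ s, HasDerivAt σ ‖G s‖ s := fun s => (hGcont.integral_hasStrictDerivAt 0 s).hasDerivAt
  have hσm : StrictMono σ := strictMono_of_hasDerivAt_pos hσd hG0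
  have hσc : Continuous σ := continuous_iff_continuousAt.2 fun s => (hσd s).continuousAt
  have hσs : Function.Surjective σ := hσc.surjective
    (hnp.tendsto_atTop_intervalIntegral_of_pos' (hGcont.intervalIntegrable _ _) hG0 hL)
    (hnp.tendsto_atBot_intervalIntegral_of_pos' (hGcont.intervalIntegrable _ _) hG0 hL)
  have hσL : ∀ s, σ (s + L) = σ s + σ L := fun s => by
    simp only [hσ]
    rw [← intervalIntegral.integral_add_adjacent_intervals (hGcont.intervalIntegrable 0 s)
      (hGcont.intervalIntegrable s (s + L)), hnp.intervalIntegral_add_eq s 0, zero_add]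
  set e : ℝ ≃o ℝ := hσm.orderIsoOfSurjective σ hσs with he
  set τ : ℝ → ℝ := fun y => e.symm y with hτ
  have hστ : ∀ y, σ (τ y) = y := fun y => hσm.orderIsoOfSurjective_self_symm_apply σ hσs y
  have hτσ : ∀ s, τ (σ s) = s := fun s => hσm.orderIsoOfSurjective_symm_apply_self σ hσs s
  have hτc : Continuous τ := e.symm.continuous
  have hτm : StrictMono τ := e.symm.strictMono
  have hτL : ∀ y, τ (y + σ L) = τ y + L := fun y => by
    rw [← hτσ (τ y + L), hσL, hστ]
  have hτd : ∀ y, HasDerivAt τ ‖G (τ y)‖⁻¹ y := fun y =>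
    HasDerivAt.of_local_left_inverse hτc.continuousAt (hσd _) (hG0 _).ne'
      (Eventually.of_forall hστ)
  have hτ0 : τ 0 = 0 := by rw [← hσ0, hτσ, hσ0]
  have hσLpos : 0 < σ L := by rw [← hσ0]; exact hσm hL
  have hτlip : LipschitzWith (Real.toNNReal c⁻¹) τ := by
    refine lipschitzWith_of_nnnorm_deriv_le (fun y => (hτd y).differentiableAt) fun y => ?_
    rw [(hτd y).deriv, ← NNReal.coe_le_coe, coe_nnnorm, Real.coe_toNNReal _ (by positivity),
      norm_inv, norm_norm]
    exact inv_anti₀ hc (hGc _)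
  let η : Knot n :=
    { L := σ L
      Lpos := hσLpos
      f := fun y => g (τ y)
      fd := fun y => ‖G (τ y)‖⁻¹ • G (τ y)
      per := fun y => by rw [hτL, hgp]
      perd := fun y => by rw [hτL, hGp]
      deriv := fun y => (hg (τ y)).scomp y (hτd y)
      unit := fun y => by rw [norm_smul, norm_inv, norm_norm, inv_mul_cancel₀ (hG0 _).ne']
      lipd := by
        refine ⟨Real.toNNReal (2 / c * (C * c⁻¹)), LipschitzWith.of_dist_le_mul fun y z => ?_⟩
        rw [dist_eq_norm, Real.coe_toNNReal _ (by positivity)]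
        refine (norm_unitize_sub_le hc (hGc _) (hGc _)).trans ?_
        rw [mul_assoc, mul_assoc]
        gcongr
        have h1 := hC.dist_le_mul (τ y) (τ z)
        have h2 := hτlip.dist_le_mul y z
        rw [Real.coe_toNNReal _ (by positivity)] at h2
        rw [dist_eq_norm] at h1
        exact h1.trans (by gcongr)
      inj := by
        intro y hy z hz hyz
        have hmem : ∀ y ∈ Ico 0 (σ L), τ y ∈ Ico 0 L := fun y hy =>
          ⟨by rw [← hτ0]; exact hτm.monotone hy.1, by rw [← hτσ L]; exact hτm hy.2⟩
        exact hτm.injective (hinj (hmem y hy) (hmem z hz) hyz) }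
  refine ⟨η, τ, rfl, fun _ => rfl, fun _ => rfl, hτc, hτm, hτL, fun u => ?_⟩
  have hlow : ∀ s, 0 ≤ s → c * s ≤ σ s := fun s hs => by
    have := intervalIntegral.integral_mono_on hs (intervalIntegrable_const (c := c))
      (hGcont.intervalIntegrable (μ := volume) 0 s) fun y _ => hGc y
    simpa [mul_comm] using this
  have hup : ∀ s, 0 ≤ s → σ s ≤ s := fun s hs => by
    have := intervalIntegral.integral_mono_on hs
      (hGcont.intervalIntegrable (μ := volume) 0 s) (intervalIntegrable_const (c := (1 : ℝ)))
      fun y _ => hG1 y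
    simpa using this
  have hper : Function.Periodic (fun s => L * σ s - σ L * s) L := fun s => by
    simp only [hσL]
    ring
  have hbound : ∀ s, |L * σ s - σ L * s| ≤ (1 - c) * L * L := fun s => by
    obtain ⟨s', hs', hss⟩ := hper.exists_mem_Ico₀ hL s
    rw [hss, abs_le]
    have h1 := hlow s' hs'.1
    have h2 := hup s' hs'.1
    have h3 := hlow L hL.le
    have h4 := hup L hL.le
    have hs0 := hs'.1
    have hs1 := hs'.2
    have hc1 : c ≤ 1 := (hGc 0).trans (hG1 0)
    have h5 : (1 - c) * s' * L ≤ (1 - c) * L * L := by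
      have : 0 ≤ 1 - c := by linarith
      gcongr
    constructor
    · nlinarith [mul_le_mul_of_nonneg_left h1 hL.le, mul_le_mul_of_nonneg_right h4 hs0]
    · nlinarith [mul_le_mul_of_nonneg_left h2 hL.le, mul_le_mul_of_nonneg_right h3 hs0]
  have h1 := hbound (τ (σ L * u))
  rw [hστ, show L * (σ L * u) - σ L * τ (σ L * u) = -(σ L * (τ (σ L * u) - L * u)) by ring,
    abs_neg, abs_mul, abs_of_pos hσLpos] at h1
  have h2 := hlow L hL.le
  change |τ (σ L * u) - L * u| ≤ _
  have h3 : c * L * |τ (σ L * u) - L * u| ≤ (1 - c) * L * L :=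
    (mul_le_mul_of_nonneg_right h2 (abs_nonneg _)).trans h1
  rw [div_mul_eq_mul_div, le_div_iff₀ hc]
  refine le_of_mul_le_mul_right ?_ hL
  linarith

lemma sameKnotClass_of_straight_homotopy {n : ℕ} {k η : Knot n} {τ : ℝ → ℝ} {φ : ℝ → Euc n}
    {e : ℝ} (hφc : Continuous φ) (hφp : Function.Periodic φ k.L)
    (hη : ∀ y, η.f y = k.f (τ y) + e • φ (τ y)) (hτc : Continuous τ) (hτm : StrictMono τ)
    (hτL : ∀ y, τ (y + η.L) = τ y + k.L)
    (hinj : ∀ r ∈ Icc (0 : ℝ) 1, InjOn (fun s => k.f s + (r * e) • φ s) (Ico 0 k.L)) :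
    SameKnotClass k η := by
  have hkc : Continuous k.f := continuous_iff_continuousAt.2 fun s => (k.deriv s).continuousAt
  set θ : ℝ → ℝ → ℝ := fun r u => (1 - r) * (k.L * u) + r * τ (η.L * u) with hθ
  have hθ1 : ∀ r u, θ r (u + 1) = θ r u + k.L := fun r u => by
    simp only [hθ]
    rw [mul_add η.L, mul_one, hτL]
    ring
  have hgp : ∀ r, Function.Periodic (fun s => k.f s + (r * e) • φ s) k.L := fun r s => by
    simp only [k.per s, hφp s]
  refine ⟨fun r u => k.f (θ r u) + (r * e) • φ (θ r u), ?_, fun r u => ?_, fun u => ?_,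
    fun u => ?_, fun r hr => ?_⟩
  · refine Continuous.continuousOn ?_
    simp only [hθ]
    fun_prop
  · simp only [hθ1]
    exact hgp r (θ r u)
  · simp [hθ]
  · simp [hθ, hη]
  · have hmono : StrictMono (θ r) := by
      intro u v huv
      have h1 : k.L * u < k.L * v := mul_lt_mul_of_pos_left huv k.Lpos
      have h2 : τ (η.L * u) < τ (η.L * v) := hτm (mul_lt_mul_of_pos_left huv η.Lpos)
      simp only [hθ]
      rcases hr.1.eq_or_lt with h0 | h0
      · rw [← h0]; linarith
      · have h3 := mul_lt_mul_of_pos_left h2 h0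
        have h4 := mul_le_mul_of_nonneg_left h1.le (sub_nonneg.2 hr.2)
        linarith
    have hmem : ∀ u ∈ Ico (0 : ℝ) 1, θ r u ∈ Ico (θ r 0) (θ r 0 + k.L) := fun u hu =>
      ⟨hmono.monotone hu.1, by rw [← hθ1, zero_add]; exact hmono hu.2⟩
    have hinj' := injOn_Ico_of_periodic (a := 0) k.Lpos (hgp r)
      (by rw [zero_add]; exact hinj r hr) (θ r 0)
    intro u hu v hv huv
    exact hmono.injective (hinj' (hmem u hu) (hmem v hv) huv)

end Reparametrization

section Perturbation

variable {E : Type*} [NormedAddCommGroup E]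

/-- A periodic bump of height one supported in the translates of `(x - δ, x + δ)`. -/
noncomputable def periodicBump (L x δ s : ℝ) : ℝ :=
  max (1 - ‖((s - x : ℝ) : AddCircle L)‖ / δ) 0

lemma periodicBump_nonneg (L x δ s : ℝ) : 0 ≤ periodicBump L x δ s := le_max_right _ _

lemma periodicBump_le_one {δ : ℝ} (hδ : 0 < δ) (L x s : ℝ) : periodicBump L x δ s ≤ 1 :=
  max_le (sub_le_self _ (by positivity)) zero_le_one

lemma periodicBump_periodic (L x δ : ℝ) : Function.Periodic (periodicBump L x δ) L := fun s => by
  rw [periodicBump, periodicBump, show s + L - x = s - x + L by ring, AddCircle.coe_add_period]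

lemma periodicBump_eq {L x δ s : ℝ} (hL : 0 < L) (hs : |s - x| ≤ L / 2) :
    periodicBump L x δ s = max (1 - |s - x| / δ) 0 := by
  rw [periodicBump, (AddCircle.norm_coe_eq_abs_iff L hL.ne').2 (by rwa [abs_of_pos hL])]

lemma periodicBump_abs_sub_le {δ : ℝ} (hδ : 0 < δ) (L x s t : ℝ) :
    |periodicBump L x δ s - periodicBump L x δ t| ≤ δ⁻¹ * |s - t| := by
  have h1 : |‖((s - x : ℝ) : AddCircle L)‖ - ‖((t - x : ℝ) : AddCircle L)‖| ≤ |s - t| := by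
    refine (abs_norm_sub_norm_le _ _).trans ?_
    rw [← AddCircle.coe_sub, sub_sub_sub_cancel_right]
    exact QuotientAddGroup.norm_mk_le_norm.trans_eq (Real.norm_eq_abs _)
  refine (abs_max_sub_max_le_abs _ _ _).trans ?_
  rw [show 1 - ‖((s - x : ℝ) : AddCircle L)‖ / δ - (1 - ‖((t - x : ℝ) : AddCircle L)‖ / δ) =
    -(δ⁻¹ * (‖((s - x : ℝ) : AddCircle L)‖ - ‖((t - x : ℝ) : AddCircle L)‖)) by ring,
    abs_neg, abs_mul, abs_of_pos (inv_pos.2 hδ)]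
  gcongr

variable [InnerProductSpace ℝ E] [CompleteSpace E]

lemma exists_shortening_variation {T : ℝ → E} {C : NNReal} {L x δ : ℝ} (hT : LipschitzWith C T)
    (hTp : Function.Periodic T L) (hunit : ∀ s, ‖T s‖ = 1) (hδ : 0 < δ) (hδL : δ < L / 2)
    (hne : ∃ y z, |y - x| < δ ∧ |z - x| < δ ∧ T y ≠ T z) :
    ∃ (φ ψ : ℝ → E) (M : NNReal), (∀ s, HasDerivAt φ (ψ s) s) ∧ Function.Periodic φ L ∧
      Function.Periodic ψ L ∧ (∀ s, ‖φ s‖ ≤ M) ∧ (∀ s, ‖ψ s‖ ≤ M) ∧ LipschitzWith M ψ ∧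
      (∀ s ∈ Icc (x - L / 2) (x + L / 2), δ ≤ |s - x| → φ s = 0 ∧ ψ s = 0) ∧
      ∀ e ∈ Ioo (0 : ℝ) 1, (∀ s, ‖T s + e • ψ s‖ ≤ 1) ∧ ∃ s, ‖T s + e • ψ s‖ < 1 := by
  have hL : 0 < L := by linarith
  set χ := periodicBump L x δ with hχ
  have hχ0 : ∀ s, 0 ≤ χ s := periodicBump_nonneg L x δ
  have hχ1 : ∀ s, χ s ≤ 1 := periodicBump_le_one hδ L x
  have hχp : Function.Periodic χ L := periodicBump_periodic L x δ
  have hχlip : LipschitzWith (Real.toNNReal δ⁻¹) χ := LipschitzWith.of_dist_le_mul fun s t => by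
    rw [Real.dist_eq, Real.dist_eq, Real.coe_toNNReal _ (by positivity)]
    exact periodicBump_abs_sub_le hδ L x s t
  have hχpos : ∀ s, |s - x| < δ → 0 < χ s := fun s hs => by
    rw [hχ, periodicBump_eq hL (hs.le.trans hδL.le)]
    exact lt_max_of_lt_left (sub_pos.2 ((div_lt_one hδ).2 hs))
  have hχz : ∀ s ∈ Icc (x - L / 2) (x + L / 2), δ ≤ |s - x| → χ s = 0 := fun s hs h => by
    rw [hχ, periodicBump_eq hL (abs_le.2 ⟨by linarith [hs.1], by linarith [hs.2]⟩)]
    exact max_eq_right (sub_nonpos.2 ((one_le_div hδ).2 h))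
  have hχc := hχlip.continuous
  have hTc := hT.continuous
  have hTχc : Continuous fun s => χ s • T s := hχc.smul hTc
  set a := x - L / 2 with ha
  have haL : x + L / 2 = a + L := by rw [ha]; ring
  rw [haL] at hχz
  rw [haL]
  set Z := ∫ s in a..a + L, χ s with hZ
  have hZpos : 0 < Z := by
    have := intervalIntegral.integral_lt_integral_of_continuousOn_of_le_of_exists_lt
      (f := fun _ => (0 : ℝ)) (g := χ) (a := a) (b := a + L) (by linarith) continuousOn_const
      hχc.continuousOn (fun s _ => hχ0 s)
      ⟨x, ⟨by rw [ha]; linarith, by rw [ha]; linarith⟩, hχpos x (by simpa using hδ)⟩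
    simpa using this
  set m : E := Z⁻¹ • ∫ s in a..a + L, χ s • T s with hm
  have hm1 : ‖m‖ ≤ 1 := by
    have h1 : ‖∫ s in a..a + L, χ s • T s‖ ≤ Z := by
      refine (intervalIntegral.norm_integral_le_integral_norm (by linarith)).trans_eq ?_
      refine intervalIntegral.integral_congr fun s _ => ?_
      rw [norm_smul, hunit, mul_one, Real.norm_eq_abs, abs_of_nonneg (hχ0 s)]
    rw [hm, norm_smul, norm_inv, Real.norm_eq_abs, abs_of_pos hZpos, inv_mul_le_one₀ hZpos]
    exact h1
  set ψ : ℝ → E := fun s => χ s • (m - T s) with hψ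
  have hψp : Function.Periodic ψ L := fun s => by simp only [hψ, hχp s, hTp s]
  have hmT : ∀ s, ‖m - T s‖ ≤ 2 := fun s => by
    have := norm_sub_le m (T s)
    rw [hunit] at this
    linarith
  have hψ2 : ∀ s, ‖ψ s‖ ≤ 2 := fun s => by
    rw [hψ, norm_smul, Real.norm_eq_abs, abs_of_nonneg (hχ0 s)]
    exact (mul_le_mul (hχ1 s) (hmT s) (norm_nonneg _) zero_le_one).trans (by norm_num)
  have hψlip : LipschitzWith (Real.toNNReal (δ⁻¹ * 2 + C)) ψ :=
    LipschitzWith.of_dist_le_mul fun s t => by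
      rw [dist_eq_norm, Real.dist_eq, Real.coe_toNNReal _ (by positivity)]
      have h1 : ψ s - ψ t = (χ s - χ t) • (m - T s) + χ t • (T t - T s) := by
        simp only [hψ, smul_sub, sub_smul]
        abel
      have h2 := hT.dist_le_mul t s
      rw [dist_eq_norm, Real.dist_eq, abs_sub_comm t s] at h2
      rw [h1]
      refine (norm_add_le _ _).trans ?_
      rw [norm_smul, norm_smul, Real.norm_eq_abs, Real.norm_eq_abs, abs_of_nonneg (hχ0 t), add_mul]
      refine add_le_add ?_ ((mul_le_of_le_one_left (norm_nonneg _) (hχ1 t)).trans h2)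
      calc |χ s - χ t| * ‖m - T s‖ ≤ δ⁻¹ * |s - t| * 2 := by
            gcongr
            · exact periodicBump_abs_sub_le hδ L x s t
            · exact hmT s
        _ = δ⁻¹ * 2 * |s - t| := by ring
  have hψc := hψlip.continuous
  have hψint : ∫ s in a..a + L, ψ s = 0 := by
    have h1 : ∀ s, ψ s = χ s • m - χ s • T s := fun s => smul_sub _ _ _
    simp_rw [h1]
    rw [intervalIntegral.integral_sub
      ((by fun_prop : Continuous fun s => χ s • m).intervalIntegrable _ _)
        (hTχc.intervalIntegrable _ _),
      intervalIntegral.integral_smul_const, ← hZ, hm, smul_smul,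
      mul_inv_cancel₀ hZpos.ne', one_smul, sub_self]
  set φ : ℝ → E := fun s => ∫ y in a..s, ψ y with hφ
  have hφd : ∀ s, HasDerivAt φ (ψ s) s := fun s => (hψc.integral_hasStrictDerivAt a s).hasDerivAt
  have hφc : Continuous φ := continuous_iff_continuousAt.2 fun s => (hφd s).continuousAt
  have hφp : Function.Periodic φ L := fun s => by
    simp only [hφ]
    rw [← intervalIntegral.integral_add_adjacent_intervals (hψc.intervalIntegrable a s)
      (hψc.intervalIntegrable s (s + L)), hψp.intervalIntegral_add_eq s a, hψint, add_zero]
  obtain ⟨B, hB⟩ := isBounded_iff_forall_norm_le.1 (hφp.isBounded_of_continuous hL.ne' hφc)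
  have hB' : ∀ s, ‖φ s‖ ≤ B := fun s => hB _ (mem_range_self s)
  have hψz : ∀ s ∈ Icc a (a + L), δ ≤ |s - x| → ψ s = 0 := fun s hs h => by
    simp only [hψ, hχz s hs h, zero_smul]
  refine ⟨φ, ψ, Real.toNNReal (δ⁻¹ * 2 + C) + 2 + Real.toNNReal B, hφd, hφp, hψp, fun s => ?_,
    fun s => ?_, hψlip.weaken ?_, fun s hs h => ⟨?_, hψz s hs h⟩, fun e he => ⟨fun s => ?_, ?_⟩⟩
  · refine ((hB' s).trans (Real.le_coe_toNNReal B)).trans ?_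
    push_cast
    exact le_add_of_nonneg_left (by positivity)
  · refine (hψ2 s).trans ?_
    push_cast
    have h1 : (0 : ℝ) ≤ (Real.toNNReal (δ⁻¹ * 2 + C) : ℝ) := NNReal.coe_nonneg _
    have h2 : (0 : ℝ) ≤ (Real.toNNReal B : ℝ) := NNReal.coe_nonneg _
    linarith
  · rw [add_assoc]
    exact le_add_of_nonneg_right (by positivity)
  · rcases le_abs'.1 h with h1 | h1
    · refine intervalIntegral.integral_zero_ae (Eventually.of_forall fun y hy => ?_)
      rw [uIoc_of_le hs.1] at hy
      exact hψz y ⟨hy.1.le, hy.2.trans hs.2⟩ (le_abs'.2 (Or.inl (by linarith [hy.2])))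
    · have h2 : ∫ y in s..a + L, ψ y = 0 := by
        refine intervalIntegral.integral_zero_ae (Eventually.of_forall fun y hy => ?_)
        rw [uIoc_of_le hs.2] at hy
        exact hψz y ⟨hs.1.trans hy.1.le, hy.2⟩ (le_abs'.2 (Or.inr (by linarith [hy.1])))
      have h3 := intervalIntegral.integral_add_adjacent_intervals
        (hψc.intervalIntegrable (μ := volume) a s) (hψc.intervalIntegrable (μ := volume) s (a + L))
      rw [h2, hψint, add_zero] at h3
      exact h3
  all_goals
    have hcombo : ∀ s, T s + e • ψ s = (1 - e * χ s) • T s + (e * χ s) • m := fun s => by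
      simp only [hψ, smul_sub, sub_smul, one_smul, mul_smul]
      abel
    have hle : ∀ s, e * χ s ≤ e := fun s => mul_le_of_le_one_right he.1.le (hχ1 s)
  · rw [hcombo]
    refine (norm_add_le _ _).trans ?_
    have h0 : 0 ≤ e * χ s := mul_nonneg he.1.le (hχ0 s)
    have h1 : 0 ≤ 1 - e * χ s := by linarith [hle s, he.2]
    rw [norm_smul, norm_smul, hunit, Real.norm_eq_abs, Real.norm_eq_abs, abs_of_nonneg h0,
      abs_of_nonneg h1]
    nlinarith
  · obtain ⟨s, hs, hsm⟩ : ∃ s, |s - x| < δ ∧ T s ≠ m := by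
      by_contra! hall
      obtain ⟨y, z, hy, hz, hyz⟩ := hne
      exact hyz ((hall y hy).trans (hall z hz).symm)
    refine ⟨s, ?_⟩
    rw [hcombo]
    exact norm_combo_lt_of_ne (hunit s).le hm1 hsm (by linarith [hle s, he.2])
      (mul_pos he.1 (hχpos s hs)) (sub_add_cancel _ _)

end Perturbation

section Shortening

lemma norm_sub_sub_smul_le_of_lipschitz {E : Type*} [NormedAddCommGroup E] [NormedSpace ℝ E]
    [CompleteSpace E] {g G : ℝ → E} {K s t : ℝ} (hg : ∀ s, HasDerivAt g (G s) s)
    (hGc : Continuous G) (hK : ∀ u ∈ uIcc s t, ‖G u - G s‖ ≤ K * |u - s|) :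
    ‖g t - g s - (t - s) • G s‖ ≤ K * (t - s) ^ 2 / 2 := by
  have hd : ∀ r : ℝ, HasDerivAt (fun r : ℝ => g (s + r * (t - s)) - (r * (t - s)) • G s)
      ((t - s) • (G (s + r * (t - s)) - G s)) r := fun r => by
    have h0 : HasDerivAt (fun r : ℝ => r * (t - s)) (t - s) r := by
      simpa using (hasDerivAt_id r).mul_const (t - s)
    rw [smul_sub]
    exact ((hg (s + r * (t - s))).scomp r (h0.const_add s)).sub (h0.smul_const (G s))
  have hint := intervalIntegral.integral_eq_sub_of_hasDerivAt (a := 0) (b := 1)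
    (fun r _ => hd r) (Continuous.intervalIntegrable (by fun_prop) _ _)
  have hval : g (s + 1 * (t - s)) - (1 * (t - s)) • G s - (g (s + 0 * (t - s)) -
      (0 * (t - s)) • G s) = g t - g s - (t - s) • G s := by
    simp only [one_mul, zero_mul, add_zero, zero_smul, sub_zero, add_sub_cancel]
    abel
  rw [hval] at hint
  rw [← hint]
  have hbound : ∫ r in (0 : ℝ)..1, K * (t - s) ^ 2 * r = K * (t - s) ^ 2 / 2 := by
    rw [intervalIntegral.integral_const_mul, integral_id]
    ring
  rw [← hbound]
  refine intervalIntegral.norm_integral_le_of_norm_le zero_le_one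
    (Eventually.of_forall fun r hr => ?_) (Continuous.intervalIntegrable (by fun_prop) _ _)
  have hmem : s + r * (t - s) ∈ uIcc s t := by
    have := (convex_uIcc s t).add_smul_sub_mem left_mem_uIcc right_mem_uIcc ⟨hr.1.le, hr.2⟩
    simpa using this
  have h1 := hK _ hmem
  rw [add_sub_cancel_left, abs_mul, abs_of_pos hr.1] at h1
  rw [norm_smul, Real.norm_eq_abs]
  calc |t - s| * ‖G (s + r * (t - s)) - G s‖ ≤ |t - s| * (K * (r * |t - s|)) := by gcongr
    _ = K * |t - s| ^ 2 * r := by ring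
    _ = K * (t - s) ^ 2 * r := by rw [sq_abs]

lemma chord_estimates_of_lipschitz {E : Type*} [NormedAddCommGroup E] [InnerProductSpace ℝ E]
    [CompleteSpace E] {g G : ℝ → E} {K R c d s t : ℝ} (hg : ∀ s, HasDerivAt g (G s) s)
    (hGc : Continuous G) (hR : 0 ≤ R) (hK0 : 0 ≤ K)
    (hK : ∀ u ∈ uIcc s t, ‖G u - G s‖ ≤ K * |u - s|) (hc : c ≤ ‖G s‖) (hd : |t - s| ≤ 2 * d)
    (hpos : 0 < c - K * d) (hRK : R * K ≤ (c - K * d) ^ 2) :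
    (s ≠ t → g s ≠ g t) ∧
      ∀ w : E, ‖w‖ = 1 → ⟪w, G s⟫ = 0 → 2 * R * ⟪g t - g s, w⟫ ≤ ‖g t - g s‖ ^ 2 := by
  have htaylor := norm_sub_sub_smul_le_of_lipschitz hg hGc hK
  have hlow : |t - s| * (c - K * d) ≤ ‖g t - g s‖ := by
    have h1 : ‖(t - s) • G s‖ - ‖g t - g s‖ ≤ ‖g t - g s - (t - s) • G s‖ := by
      rw [norm_sub_rev (g t - g s)]
      exact norm_sub_norm_le _ _
    rw [norm_smul, Real.norm_eq_abs] at h1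
    rw [← sq_abs] at htaylor
    have h2 := mul_le_mul_of_nonneg_left hc (abs_nonneg (t - s))
    have h3 := mul_le_mul_of_nonneg_left hd (mul_nonneg hK0 (abs_nonneg (t - s)))
    nlinarith
  refine ⟨fun hst heq => ?_, fun w hw hws => ?_⟩
  · rw [heq, sub_self, norm_zero] at hlow
    have : 0 < |t - s| := abs_pos.2 (sub_ne_zero.2 hst.symm)
    nlinarith
  · have h1 : ⟪g t - g s, w⟫ = ⟪g t - g s - (t - s) • G s, w⟫ := by
      rw [inner_sub_left _ ((t - s) • G s), real_inner_smul_left, real_inner_comm w (G s), hws]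
      ring
    have h2 : ⟪g t - g s, w⟫ ≤ K * (t - s) ^ 2 / 2 := by
      rw [h1]
      refine (real_inner_le_norm _ _).trans ?_
      rwa [hw, mul_one]
    calc 2 * R * ⟪g t - g s, w⟫ ≤ 2 * R * (K * (t - s) ^ 2 / 2) := by gcongr
      _ = (t - s) ^ 2 * (R * K) := by ring
      _ ≤ (t - s) ^ 2 * (c - K * d) ^ 2 := by gcongr
      _ = (|t - s| * (c - K * d)) ^ 2 := by rw [mul_pow, sq_abs]
      _ ≤ ‖g t - g s‖ ^ 2 := by gcongr

variable {n : ℕ}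

lemma Knot.continuous_f_s19 (k : Knot n) : Continuous k.f :=
  continuous_iff_continuousAt.2 fun s => (k.deriv s).continuousAt

lemma Knot.continuous_fd_s19 (k : Knot n) : Continuous k.fd := by
  obtain ⟨C, hC⟩ := k.lipd
  exact hC.continuous

lemma Knot.eq_of_abs_sub_lt (k : Knot n) {s t : ℝ} (h : k.f s = k.f t) (hst : |s - t| < k.L) :
    s = t := by
  have hinj := injOn_Ico_of_periodic (a := 0) k.Lpos k.per (by rw [zero_add]; exact k.inj)
  rw [abs_lt] at hst
  rcases le_total s t with hle | hle
  · exact hinj s ⟨le_rfl, by linarith [k.Lpos]⟩ ⟨hle, by linarith⟩ h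
  · exact hinj t ⟨hle, by linarith⟩ ⟨le_rfl, by linarith [k.Lpos]⟩ h

lemma Knot.norm_f_sub_le (k : Knot n) (s t : ℝ) : ‖k.f s - k.f t‖ ≤ |s - t| := by
  have := Convex.norm_image_sub_le_of_norm_hasDerivWithin_le (f := k.f) (f' := k.fd) (C := 1)
    (fun y _ => (k.deriv y).hasDerivWithinAt) (fun y _ => (k.unit y).le) convex_univ
    (mem_univ t) (mem_univ s)
  rwa [one_mul, Real.norm_eq_abs] at this

lemma continuous_tangentGap {X E : Type*} [TopologicalSpace X] [NormedAddCommGroup E]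
    [InnerProductSpace ℝ E] (R : ℝ) {v u : X → E} (hv : Continuous v) (hu : Continuous u) :
    Continuous fun z => tangentGap R (v z) (u z) := by
  unfold tangentGap
  fun_prop

lemma ne_of_tangentGap_pos {E : Type*} [NormedAddCommGroup E] [InnerProductSpace ℝ E] {R : ℝ}
    {p q u : E} (h : 0 < tangentGap R (p - q) u) : p ≠ q := by
  rintro rfl
  simp [tangentGap] at h

lemma ne_zero_of_tangentGap_pos {E : Type*} [NormedAddCommGroup E] [InnerProductSpace ℝ E] {R : ℝ}
    {v u : E} (h : 0 < tangentGap R v u) : u ≠ 0 := by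
  rintro rfl
  simp [tangentGap] at h

lemma isCompact_Icc_inter_le_abs_sub (a b x δ : ℝ) :
    IsCompact {t : ℝ | t ∈ Icc a b ∧ δ ≤ |t - x|} :=
  isCompact_Icc.inter_right
    (isClosed_le continuous_const (continuous_abs.comp (continuous_id.sub continuous_const)))

lemma Knot.eventually_thick_variation (k : Knot n) {R Λ x δ δ₁ : ℝ} {φ ψ : ℝ → Euc n}
    {M : NNReal} (hR : 0 ≤ R) (hthick : Thick R k.f k.fd) (hΛ0 : 0 ≤ Λ)
    (hΛ : ∀ s t, |s - x| < δ₁ → |t - x| < δ₁ → ‖k.fd s - k.fd t‖ ≤ Λ * |s - t|)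
    (hδ₁ : 0 < 1 - Λ * δ₁) (hRΛ : R * Λ < (1 - Λ * δ₁) ^ 2)
    (hgap : ∀ s, |s - x| ≤ δ → ∀ t ∈ Icc (x - k.L / 2) (x + k.L / 2), δ₁ ≤ |t - x| →
      0 < tangentGap R (k.f t - k.f s) (k.fd s) ∧ 0 < tangentGap R (k.f s - k.f t) (k.fd t))
    (hφ : ∀ s, HasDerivAt φ (ψ s) s) (hφp : Function.Periodic φ k.L)
    (hψp : Function.Periodic ψ k.L) (hψM : ∀ s, ‖ψ s‖ ≤ M) (hψ : LipschitzWith M ψ)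
    (hzero : ∀ s ∈ Icc (x - k.L / 2) (x + k.L / 2), δ ≤ |s - x| → φ s = 0 ∧ ψ s = 0)
    (hδδ₁ : δ ≤ δ₁) :
    ∀ᶠ e in 𝓝 (0 : ℝ), Thick R (fun s => k.f s + e • φ s) (fun s => k.fd s + e • ψ s) ∧
      InjOn (fun s => k.f s + e • φ s) (Ico 0 k.L) := by
  have hφc : Continuous φ := continuous_iff_continuousAt.2 fun s => (hφ s).continuousAt
  have hψc := hψ.continuous
  have hfc := k.continuous_f_s19
  have hTc := k.continuous_fd_s19
  set F : Set ℝ := {t | t ∈ Icc (x - k.L / 2) (x + k.L / 2) ∧ δ₁ ≤ |t - x|} with hF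
  have hFc : IsCompact F := isCompact_Icc_inter_le_abs_sub _ _ _ _
  have hcross : ∀ᶠ e in 𝓝 (0 : ℝ), ∀ p ∈ Metric.closedBall x δ ×ˢ F,
      0 < tangentGap R (k.f p.2 + e • φ p.2 - (k.f p.1 + e • φ p.1)) (k.fd p.1 + e • ψ p.1) ∧
      0 < tangentGap R (k.f p.1 + e • φ p.1 - (k.f p.2 + e • φ p.2)) (k.fd p.2 + e • ψ p.2) := by
    refine ((isCompact_closedBall x δ).prod hFc).eventually_forall_of_forall_eventually ?_
    rintro ⟨s, t⟩ ⟨hs, ht⟩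
    have h0 := hgap s (by simpa [Real.dist_eq] using hs) t ht.1 ht.2
    have hc1 : Continuous fun z : ℝ × ℝ × ℝ => tangentGap R
        (k.f z.2.2 + z.1 • φ z.2.2 - (k.f z.2.1 + z.1 • φ z.2.1))
        (k.fd z.2.1 + z.1 • ψ z.2.1) :=
      continuous_tangentGap R (by fun_prop) (by fun_prop)
    have hc2 : Continuous fun z : ℝ × ℝ × ℝ => tangentGap R
        (k.f z.2.1 + z.1 • φ z.2.1 - (k.f z.2.2 + z.1 • φ z.2.2))
        (k.fd z.2.2 + z.1 • ψ z.2.2) :=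
      continuous_tangentGap R (by fun_prop) (by fun_prop)
    refine (hc1.continuousAt.eventually_const_lt ?_).and (hc2.continuousAt.eventually_const_lt ?_)
    · simpa using h0.1
    · simpa using h0.2
  have hnear : ∀ᶠ e in 𝓝 (0 : ℝ), 0 < 1 - |e| * M - (Λ + |e| * M) * δ₁ ∧
      R * (Λ + |e| * M) < (1 - |e| * M - (Λ + |e| * M) * δ₁) ^ 2 := by
    have hc1 : Continuous fun e : ℝ => R * (Λ + |e| * M) := by fun_prop
    have hc2 : Continuous fun e : ℝ => 1 - |e| * M - (Λ + |e| * M) * δ₁ := by fun_prop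
    refine (hc2.continuousAt.eventually_const_lt ?_).and
      (hc1.continuousAt.eventually_lt (hc2.pow 2).continuousAt ?_)
    · simpa using hδ₁
    · simpa using hRΛ
  filter_upwards [hcross, hnear] with e hcross hnear
  set g : ℝ → Euc n := fun s => k.f s + e • φ s with hg
  set G : ℝ → Euc n := fun s => k.fd s + e • ψ s with hG
  have hgd : ∀ s, HasDerivAt g (G s) s := fun s => (k.deriv s).add ((hφ s).const_smul e)
  have hGc : Continuous G := by fun_prop
  have hgp : Function.Periodic g k.L := fun s => by simp only [hg, k.per s, hφp s]
  have hGp : Function.Periodic G k.L := fun s => by simp only [hG, k.perd s, hψp s]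
  have heψ : ∀ s, ‖e • ψ s‖ ≤ |e| * M := fun s => by
    rw [norm_smul, Real.norm_eq_abs]
    gcongr
    exact hψM s
  set a := x - k.L / 2 with ha
  have haL : x + k.L / 2 = a + k.L := by rw [ha]; ring
  have hkey : ∀ s ∈ Ico a (a + k.L), ∀ t ∈ Ico a (a + k.L), (s ≠ t → g s ≠ g t) ∧
      ∀ w, ‖w‖ = 1 → ⟪w, G s⟫ = 0 → 2 * R * ⟪g t - g s, w⟫ ≤ ‖g t - g s‖ ^ 2 := by
    intro s hs t ht
    by_cases hs1 : |s - x| < δ₁ ∧ |t - x| < δ₁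
    · obtain ⟨hs1, ht1⟩ := hs1
      have hball : ∀ u ∈ uIcc s t, |u - x| < δ₁ := fun u hu => by
        have := (convex_ball x δ₁).ordConnected.uIcc_subset
          (by simpa [Real.dist_eq] using hs1) (by simpa [Real.dist_eq] using ht1) hu
        simpa [Real.dist_eq] using this
      refine chord_estimates_of_lipschitz (c := 1 - |e| * M) (d := δ₁) (K := Λ + |e| * M) hgd hGc
        hR (by positivity) (fun u hu => ?_) ?_ ?_ hnear.1 hnear.2.le
      · have h1 : G u - G s = (k.fd u - k.fd s) + e • (ψ u - ψ s) := by
          simp only [hG, smul_sub]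
          abel
        have h2 := hψ.dist_le_mul u s
        rw [dist_eq_norm, Real.dist_eq] at h2
        rw [h1, add_mul, mul_assoc]
        refine (norm_add_le _ _).trans (add_le_add (hΛ u s (hball u hu) hs1) ?_)
        rw [norm_smul, Real.norm_eq_abs]
        gcongr
      · have h1 := norm_sub_le (k.fd s + e • ψ s) (e • ψ s)
        rw [add_sub_cancel_right, k.unit] at h1
        linarith [heψ s]
      · have := abs_sub_le t x s
        rw [abs_sub_comm x s] at this
        linarith

    by_cases hsδ : δ ≤ |s - x| ∧ δ ≤ |t - x|
    · obtain ⟨hs2, hs3⟩ := hzero s ⟨hs.1, haL ▸ hs.2.le⟩ hsδ.1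
      obtain ⟨ht2, ht3⟩ := hzero t ⟨ht.1, haL ▸ ht.2.le⟩ hsδ.2
      simp only [hg, hG, hs2, hs3, ht2, smul_zero, add_zero]
      refine ⟨fun hne heq => hne (k.eq_of_abs_sub_lt heq ?_), fun w hw hws => hthick s t w hw hws⟩
      rw [abs_lt]
      exact ⟨by linarith [hs.1, ht.2], by linarith [hs.2, ht.1]⟩
    rcases lt_or_ge |s - x| δ with hs2 | hs2
    · have ht1 : δ₁ ≤ |t - x| := not_lt.1 fun h => hs1 ⟨hs2.trans_le hδδ₁, h⟩
      have hm := hcross (s, t) ⟨by simpa [Real.dist_eq] using hs2.le, ⟨ht.1, haL ▸ ht.2.le⟩, ht1⟩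
      exact ⟨fun _ => ne_of_tangentGap_pos hm.2, fun w hw hws =>
        le_of_tangentGap_nonneg (ne_zero_of_tangentGap_pos hm.1) hm.1.le hw hws⟩
    · have ht2 : |t - x| < δ := not_le.1 fun h => hsδ ⟨hs2, h⟩
      have hs3 : δ₁ ≤ |s - x| := not_lt.1 fun h => hs1 ⟨h, ht2.trans_le hδδ₁⟩
      have hm := hcross (t, s) ⟨by simpa [Real.dist_eq] using ht2.le, ⟨hs.1, haL ▸ hs.2.le⟩, hs3⟩
      exact ⟨fun _ => ne_of_tangentGap_pos hm.1, fun w hw hws =>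
        le_of_tangentGap_nonneg (ne_zero_of_tangentGap_pos hm.2) hm.2.le hw hws⟩
  have hmod : ∀ {α : Type} (h : ℝ → α), Function.Periodic h k.L →
      ∀ s, h (toIcoMod k.Lpos a s) = h s := fun h hp s => by
    rw [toIcoMod]; exact hp.sub_zsmul_eq _
  refine ⟨fun s t w hw hws => ?_, ?_⟩
  · rw [← hmod G hGp s] at hws
    rw [← hmod g hgp s, ← hmod g hgp t]
    exact (hkey _ (toIcoMod_mem_Ico _ _ _) _ (toIcoMod_mem_Ico _ _ _)).2 w hw hws
  · have hI : InjOn g (Ico a (a + k.L)) := fun s hs t ht hst => by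
      by_contra hne
      exact (hkey s hs t ht).1 hne hst
    have := injOn_Ico_of_periodic k.Lpos hgp hI 0
    rwa [zero_add] at this

lemma Knot.eventually_tangentGap_pos (k : Knot n) {R x Λ δ₁ : ℝ} (hthick : Thick R k.f k.fd)
    (hR : 0 < R) (hRΛ : R * Λ < 1) (hΛ : ∀ᶠ s in 𝓝 x, ‖k.fd s - k.fd x‖ ≤ Λ * |s - x|)
    (hno : ∀ y, k.f x ≠ k.f y → ⟪k.f x - k.f y, k.fd x⟫ = 0 → ⟪k.f x - k.f y, k.fd y⟫ = 0 →
      ‖k.f x - k.f y‖ ≠ 2 * R) (hδ₁ : 0 < δ₁) :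
    ∀ᶠ s in 𝓝 x, ∀ t ∈ {t | t ∈ Icc (x - k.L / 2) (x + k.L / 2) ∧ δ₁ ≤ |t - x|},
      0 < tangentGap R (k.f t - k.f s) (k.fd s) ∧ 0 < tangentGap R (k.f s - k.f t) (k.fd t) := by
  have hfc := k.continuous_f_s19
  have hTc := k.continuous_fd_s19
  have hL := k.Lpos
  refine (isCompact_Icc_inter_le_abs_sub _ _ _ _).eventually_forall_of_forall_eventually
    fun t ht => ?_
  have hne : k.f t ≠ k.f x := fun h => by
    have htx : |t - x| < k.L := by
      rw [abs_lt]
      exact ⟨by linarith [ht.1.1], by linarith [ht.1.2]⟩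
    have := ht.2
    rw [k.eq_of_abs_sub_lt h htx, sub_self, abs_zero] at this
    linarith
  have h0 := tangentGap_pos_of_no_critical k.deriv hTc k.unit hthick hR hRΛ hΛ hno hne
  have hc1 : Continuous fun z : ℝ × ℝ => tangentGap R (k.f z.2 - k.f z.1) (k.fd z.1) :=
    continuous_tangentGap _ (by fun_prop) (by fun_prop)
  have hc2 : Continuous fun z : ℝ × ℝ => tangentGap R (k.f z.1 - k.f z.2) (k.fd z.2) :=
    continuous_tangentGap _ (by fun_prop) (by fun_prop)
  have h1 : ∀ᶠ z : ℝ × ℝ in 𝓝 (x, t), 0 < tangentGap R (k.f z.2 - k.f z.1) (k.fd z.1) :=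
    hc1.continuousAt.eventually_const_lt h0.1
  have h2 : ∀ᶠ z : ℝ × ℝ in 𝓝 (x, t), 0 < tangentGap R (k.f z.1 - k.f z.2) (k.fd z.2) :=
    hc2.continuousAt.eventually_const_lt h0.2
  filter_upwards [h1, h2] with z hz1 hz2 using ⟨hz1, hz2⟩

lemma integral_norm_lt_of_le_one {E : Type*} [NormedAddCommGroup E] {G : ℝ → E} {L : ℝ}
    (hL : 0 < L) (hGc : Continuous G) (hGp : Function.Periodic G L) (hG : ∀ s, ‖G s‖ ≤ 1)
    (hlt : ∃ s, ‖G s‖ < 1) : ∫ s in (0 : ℝ)..L, ‖G s‖ < L := by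
  obtain ⟨s, hs⟩ := hlt
  obtain ⟨t, ht, hst⟩ := hGp.exists_mem_Ico₀ hL s
  have := intervalIntegral.integral_lt_integral_of_continuousOn_of_le_of_exists_lt (g := fun _ => 1)
    hL hGc.norm.continuousOn continuousOn_const (fun y _ => hG y)
    ⟨t, Ico_subset_Icc_self ht, by rwa [← hst]⟩
  simpa using this

lemma Knot.exists_shorter_knot (k : Knot n) {R ε : ℝ} {C M : NNReal} {φ ψ : ℝ → Euc n}
    (hC : LipschitzWith C k.fd) (hε : 0 < ε)
    (hφ : ∀ s, HasDerivAt φ (ψ s) s) (hφp : Function.Periodic φ k.L)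
    (hψp : Function.Periodic ψ k.L) (hφM : ∀ s, ‖φ s‖ ≤ M) (hψM : ∀ s, ‖ψ s‖ ≤ M)
    (hψ : LipschitzWith M ψ)
    (hshort : ∀ e ∈ Ioo (0 : ℝ) 1, (∀ s, ‖k.fd s + e • ψ s‖ ≤ 1) ∧ ∃ s, ‖k.fd s + e • ψ s‖ < 1)
    (hthick : ∀ᶠ e in 𝓝 (0 : ℝ), Thick R (fun s => k.f s + e • φ s) (fun s => k.fd s + e • ψ s) ∧
      InjOn (fun s => k.f s + e • φ s) (Ico 0 k.L)) :
    ∃ η : Knot n, SameKnotClass k η ∧ Thick R η.f η.fd ∧ η.L < k.L ∧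
      ∀ s : ℝ, ‖η.f (η.L * s) - k.f (k.L * s)‖ +
        ‖η.L • η.fd (η.L * s) - k.L • k.fd (k.L * s)‖ < ε := by
  have hL := k.Lpos
  have hψc := hψ.continuous
  have hTc := k.continuous_fd_s19
  have hφc : Continuous φ := continuous_iff_continuousAt.2 fun s => (hφ s).continuousAt
  set B : ℝ → ℝ := fun e =>
    (1 + k.L * C) * (2 * (|e| * M) * k.L) + |e| * M + 2 * (|e| * M) * k.L with hB
  have hBc : Continuous B := by fun_prop
  have hMc : Continuous fun e : ℝ => |e| * M := by fun_prop
  have hev := hthick.and ((hBc.continuousAt.eventually_lt_const (by simpa [hB] using hε)).and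
    (hMc.continuousAt.eventually_lt_const (u := 1 / 2) (by simp)))
  obtain ⟨e₀, he₀, hball⟩ := Metric.eventually_nhds_iff.1 hev
  set e := min (e₀ / 2) (1 / 2) with he
  have hepos : 0 < e := by positivity
  have he1 : e < 1 := (min_le_right _ _).trans_lt (by norm_num)
  have hee : e < e₀ := (min_le_left _ _).trans_lt (by linarith)
  have hseg : ∀ r ∈ Icc (0 : ℝ) 1, dist (r * e) 0 < e₀ := fun r hr => by
    rw [Real.dist_eq, sub_zero, abs_of_nonneg (mul_nonneg hr.1 hepos.le)]
    nlinarith [hr.1, hr.2]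
  obtain ⟨⟨hth, hinj⟩, hBe, hMe⟩ := hball (by simpa using hseg 1 (by simp))
  rw [abs_of_pos hepos] at hMe
  simp only [hB, abs_of_pos hepos] at hBe
  obtain ⟨hG1, hGlt⟩ := hshort e ⟨hepos, he1⟩
  set m := e * (M : ℝ) with hm
  have hm0 : 0 ≤ m := by positivity
  have hsmul : ∀ v : Euc n, ‖v‖ ≤ M → ‖e • v‖ ≤ m := fun v hv => by
    rw [norm_smul, Real.norm_eq_abs, abs_of_pos hepos]
    exact mul_le_mul_of_nonneg_left hv hepos.le
  set G : ℝ → Euc n := fun s => k.fd s + e • ψ s with hG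
  have hGc : ∀ s, 1 - m ≤ ‖G s‖ := fun s => by
    have h1 := norm_sub_le (k.fd s + e • ψ s) (e • ψ s)
    rw [add_sub_cancel_right, k.unit] at h1
    linarith [hsmul _ (hψM s)]
  have hGp : Function.Periodic G k.L := fun s => by simp only [hG, k.perd s, hψp s]
  have hGcont : Continuous G := by fun_prop
  have hc : 0 < 1 - m := by linarith
  obtain ⟨η, τ, hηL, hηf, hηd, hτc, hτm, hτL, hτ⟩ := exists_knot_reparametrization hL
    (g := fun s => k.f s + e • φ s) (G := G)
    (fun s => (k.deriv s).add ((hφ s).const_smul e))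
    (fun s => by simp only [k.per s, hφp s]) hGp hinj
    ⟨_, hC.add ((lipschitzWith_smul e).comp hψ)⟩ hc hGc hG1
  have hlt : η.L < k.L := hηL ▸ integral_norm_lt_of_le_one hL hGcont hGp hG1 hGlt
  have hge : (1 - m) * k.L ≤ η.L := by
    have := intervalIntegral.integral_mono_on hL.le (intervalIntegrable_const (c := 1 - m))
      (hGcont.norm.intervalIntegrable (μ := volume) 0 k.L) fun y _ => hGc y
    rw [intervalIntegral.integral_const, sub_zero, smul_eq_mul, ← hηL] at this
    rwa [mul_comm]
  refine ⟨η, sameKnotClass_of_straight_homotopy hφc hφp hηf hτc hτm hτL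
    fun r hr => (hball (hseg r hr)).1.2, fun s t w hw hws => ?_, hlt, fun u => ?_⟩
  · rw [hηf, hηf]
    refine hth (τ s) (τ t) w hw ?_
    rw [hηd, real_inner_smul_right] at hws
    exact (mul_eq_zero.1 hws).resolve_left (inv_ne_zero (hc.trans_le (hGc _)).ne')
  · set a := τ (η.L * u) with ha
    have hau : |a - k.L * u| ≤ 2 * m * k.L := by
      refine (hτ u).trans ?_
      gcongr
      rw [div_le_iff₀ hc]
      nlinarith
    have h1 : ‖η.f (η.L * u) - k.f (k.L * u)‖ ≤ 2 * m * k.L + m := by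
      rw [hηf, ← ha, add_sub_right_comm]
      exact (norm_add_le _ _).trans
        (add_le_add ((k.norm_f_sub_le _ _).trans hau) (hsmul _ (hφM a)))
    have h2 : ‖η.L • η.fd (η.L * u) - k.L • k.fd (k.L * u)‖ ≤
        m * k.L + (k.L * m + k.L * (C * (2 * m * k.L))) := by
      have hG0 : 0 < ‖G a‖ := hc.trans_le (hGc a)
      have hsplit : η.L • η.fd (η.L * u) - k.L • k.fd (k.L * u) =
          ((η.L - k.L * ‖G a‖) * ‖G a‖⁻¹) • G a +
            (k.L • (e • ψ a) + k.L • (k.fd a - k.fd (k.L * u))) := by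
        rw [hηd, ← ha, sub_mul, mul_assoc k.L, mul_inv_cancel₀ hG0.ne', mul_one, sub_smul,
          smul_smul]
        simp only [hG, smul_add, smul_sub]
        abel
      rw [hsplit]
      refine (norm_add_le _ _).trans (add_le_add ?_ ((norm_add_le _ _).trans (add_le_add ?_ ?_)))
      · rw [norm_smul, norm_mul, norm_inv, norm_norm, mul_assoc, inv_mul_cancel₀ hG0.ne', mul_one,
          Real.norm_eq_abs, abs_le]
        constructor <;> nlinarith [hGc a, hG1 a]
      · rw [norm_smul, Real.norm_eq_abs, abs_of_pos hL]
        gcongr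
        exact hsmul _ (hψM a)
      · rw [norm_smul, Real.norm_eq_abs, abs_of_pos hL]
        gcongr
        have := hC.dist_le_mul a (k.L * u)
        rw [dist_eq_norm, Real.dist_eq] at this
        exact this.trans (by gcongr)
    nlinarith

lemma Knot.locally_constant_of_no_critical (k : Knot n) (hext : RelativelyExtremal k) {x : ℝ}
    (hcurv : curvAt k.fd univ x < (RO k.f k.fd univ)⁻¹)
    (hno : ∀ y, k.f x ≠ k.f y → ⟪k.f x - k.f y, k.fd x⟫ = 0 → ⟪k.f x - k.f y, k.fd y⟫ = 0 →
      ‖k.f x - k.f y‖ ≠ 2 * RO k.f k.fd univ) :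
    ∃ ε > 0, ∀ y z : ℝ, |y - x| < ε → |z - x| < ε → k.fd y = k.fd z := by
  have hL := k.Lpos
  have hR : 0 < RO k.f k.fd univ :=
    inv_pos.1 ((Real.sInf_nonneg fun _ h => h.1).trans_lt hcurv)
  obtain ⟨Λ, hΛ0, hΛlt, δ₀, hδ₀, hΛ⟩ := k.exists_local_lipschitz hcurv
  have hRΛ : RO k.f k.fd univ * Λ < 1 := by
    rwa [← lt_inv_mul_iff₀ hR, mul_one]
  have hsmall : ∀ᶠ δ in 𝓝[>] (0 : ℝ), 0 < δ ∧ δ < δ₀ ∧ δ < k.L / 2 ∧ 0 < 1 - Λ * δ ∧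
      RO k.f k.fd univ * Λ < (1 - Λ * δ) ^ 2 := by
    have hc : Continuous fun δ : ℝ => 1 - Λ * δ := by fun_prop
    refine eventually_mem_nhdsWithin.and (eventually_nhdsWithin_of_eventually_nhds
      ((eventually_lt_nhds hδ₀).and ((eventually_lt_nhds (by linarith)).and
        ((hc.continuousAt.eventually_const_lt (by simp)).and
          ((hc.pow 2).continuousAt.eventually_const_lt (by simpa using hRΛ))))))
  obtain ⟨δ₁, hδ₁, hδ₁₀, hδ₁L, hδ₁Λ, hδ₁R⟩ := hsmall.exists
  have hΛx : ∀ᶠ s in 𝓝 x, ‖k.fd s - k.fd x‖ ≤ Λ * |s - x| := by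
    filter_upwards [Metric.ball_mem_nhds x hδ₀] with s hs
    exact hΛ s x (by simpa [Real.dist_eq] using hs) (by simpa using hδ₀)
  obtain ⟨δ₂, hδ₂, hgap⟩ :=
    Metric.eventually_nhds_iff.1 (k.eventually_tangentGap_pos (thick_RO _ _) hR hRΛ hΛx hno hδ₁)
  by_contra! hcon
  set δ := min δ₁ (δ₂ / 2) with hδ
  have hδpos : 0 < δ := by positivity
  have hδδ₁ : δ ≤ δ₁ := min_le_left _ _
  have hδδ₂ : δ < δ₂ := (min_le_right _ _).trans_lt (by linarith)
  obtain ⟨C, hC⟩ := k.lipd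
  obtain ⟨φ, ψ, M, hφ, hφp, hψp, hφM, hψM, hψ, hzero, hshort⟩ :=
    exists_shortening_variation hC k.perd k.unit hδpos (hδδ₁.trans_lt hδ₁L) (hcon δ hδpos)
  have hthick := k.eventually_thick_variation hR.le (thick_RO _ _) hΛ0
    (fun s t hs ht => hΛ s t (hs.trans hδ₁₀) (ht.trans hδ₁₀)) hδ₁Λ hδ₁R
    (fun s hs t ht htx => hgap (by rw [Real.dist_eq]; linarith) t ⟨ht, htx⟩)
    hφ hφp hψp hψM hψ hzero hδδ₁
  obtain ⟨ε, hε, hmin⟩ := hext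
  obtain ⟨η, hclass, hηthick, hηL, hclose⟩ :=
    k.exists_shorter_knot hC hε hφ hφp hψp hφM hψM hψ hshort hthick
  have hRη := η.le_RO_of_thick hηthick
  have h1 : η.ropelength ≤ η.L / RO k.f k.fd univ :=
    div_le_div_of_nonneg_left η.Lpos.le hR hRη
  have h2 : η.L / RO k.f k.fd univ < k.ropelength := div_lt_div_of_pos_right hηL hR
  exact absurd (hmin η hclass hclose) (not_le.2 (h1.trans_lt h2))

end Shortening

/-- Let `γ` be a relatively extremal knot. (i) If `MDC(K) = 2·R_O(K)`,
then around every `x` with `κγ(x) < 1/R_O(K)` and `x ∉ I_c` the derivative is locally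
constant; in particular `I_b ⊆ I_c`. (ii) If `MDC(K) > 2·R_O(K)`, then around every `x`
with `κγ(x) < 1/R_O(K)` the derivative is locally constant. -/
theorem statement_19 {n : ℕ} (hn : 2 ≤ n) (γ : Knot n)
    (hext : RelativelyExtremal γ) :
    (MDC γ.f γ.fd = 2 * RO γ.f γ.fd Set.univ →
      ((∀ x : ℝ, curvAt γ.fd Set.univ x < (RO γ.f γ.fd Set.univ)⁻¹ → x ∉ γ.Ic →
          ∃ ε > 0, ∀ y z : ℝ, |y - x| < ε → |z - x| < ε → γ.fd y = γ.fd z) ∧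
        {x : ℝ | 0 < curvAt γ.fd Set.univ x ∧
          curvAt γ.fd Set.univ x < (RO γ.f γ.fd Set.univ)⁻¹} ⊆ γ.Ic)) ∧
    (MDC γ.f γ.fd > 2 * RO γ.f γ.fd Set.univ →
      ∀ x : ℝ, curvAt γ.fd Set.univ x < (RO γ.f γ.fd Set.univ)⁻¹ →
        ∃ ε > 0, ∀ y z : ℝ, |y - x| < ε → |z - x| < ε → γ.fd y = γ.fd z) := by
  have hle : ∀ x y, γ.f x ≠ γ.f y → ⟪γ.f x - γ.f y, γ.fd x⟫ = 0 → ⟪γ.f x - γ.f y, γ.fd y⟫ = 0 →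
      MDC γ.f γ.fd ≤ ‖γ.f x - γ.f y‖ := fun x y h1 h2 h3 =>
    csInf_le ⟨0, by rintro _ ⟨_, _, _, _, _, rfl⟩; exact norm_nonneg _⟩ ⟨x, y, h1, h2, h3, rfl⟩
  refine ⟨fun hM => ?_, fun hM x hx => ?_⟩
  · have hconst : ∀ x : ℝ, curvAt γ.fd univ x < (RO γ.f γ.fd univ)⁻¹ → x ∉ γ.Ic →
        ∃ ε > 0, ∀ y z : ℝ, |y - x| < ε → |z - x| < ε → γ.fd y = γ.fd z := fun x hx hxc =>
      γ.locally_constant_of_no_critical hext hx fun y h1 h2 h3 h4 =>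
        hxc ⟨y, h1, h2, h3, h4.trans hM.symm⟩
    refine ⟨hconst, fun x hx => ?_⟩
    by_contra hxc
    obtain ⟨ε, hε, h⟩ := hconst x hx.2 hxc
    exact absurd hx.1 (γ.curvAt_le_zero_of_locally_constant hε h).not_gt
  · exact γ.locally_constant_of_no_critical hext hx fun y h1 h2 h3 h4 =>
      absurd (hle x y h1 h2 h3) (not_le.2 (h4 ▸ hM))
end
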